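/- Let z ∈ ℂ with Re(z) > 0. There exists a constant C > 0 (depending only on z) such that for all reals x ≥ 2 and all T ≥ 4(1 + |Im(z)|) + 3 one has ∫_{1/2}^{1} ∫_{T/2}^{T} |ζ(σ + it + z)|⁴ / |ζ(2(σ + it))| · x^{σ}/|σ + it| dt dσ ≤ C · (log T)^4 (log log T) · (x − x^{1/2}) / log x. -/

import Mathlib

open Complex Finset
open scoped Classical

/-- Summand of the telescoping expansion of `(s - 1) ζ(s) - 1`. -/
noncomputable def zetaTelescope (n : ℕ) (s : ℂ) : ℂ :=
  (s - 1) * ((n + 1 : ℝ) : ℂ) ^ (-s) + ((n + 2 : ℝ) : ℂ) ^ (1 - s) - ((n + 1 : ℝ) : ℂ) ^ (1 - s)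

lemma norm_cpow_neg_sub_cpow_neg_le {y : ℝ} (hy : 0 < y) {s : ℂ} (hs : 0 < s.re) {x : ℝ}
    (hx : x ∈ Set.Icc y (y + 1)) :
    ‖(x : ℂ) ^ (-s) - (y : ℂ) ^ (-s)‖ ≤ ‖s‖ * y ^ (-s.re - 1) := by
  have hs0 : -s ≠ 0 := by
    intro h
    rw [neg_eq_zero] at h
    simp [h] at hs
  have h := (convex_Icc y (y + 1)).norm_image_sub_le_of_norm_hasDerivWithin_le
    (f := fun x : ℝ => (x : ℂ) ^ (-s)) (f' := fun x : ℝ => -s * (x : ℂ) ^ (-s - 1))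
    (C := ‖s‖ * y ^ (-s.re - 1)) (x := y) (y := x) ?_ ?_ ⟨le_rfl, by linarith⟩ hx
  · refine h.trans ?_
    have h1 : ‖x - y‖ ≤ 1 := by
      rw [Real.norm_eq_abs, abs_le]; constructor <;> linarith [hx.1, hx.2]
    exact mul_le_of_le_one_right (by positivity) h1
  · intro u hu
    have hu0 : 0 < u := hy.trans_le hu.1
    exact (hasDerivAt_ofReal_cpow_const hu0.ne' hs0).hasDerivWithinAt
  · intro u hu
    have hu0 : 0 < u := hy.trans_le hu.1
    rw [norm_mul, norm_neg, norm_cpow_eq_rpow_re_of_pos hu0]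
    gcongr
    simp only [sub_re, neg_re, one_re]
    exact Real.rpow_le_rpow_of_nonpos hy hu.1 (by linarith)

lemma norm_zetaTelescope_le (n : ℕ) {s : ℂ} (hs : 0 < s.re) :
    ‖zetaTelescope n s‖ ≤ ‖s - 1‖ * (‖s‖ * (n + 1 : ℝ) ^ (-s.re - 1)) := by
  set y : ℝ := n + 1 with hy
  have hy0 : 0 < y := by positivity
  rcases eq_or_ne s 1 with rfl | h1
  · simp [zetaTelescope]
  have hs0 : (1 - s) ≠ 0 := sub_ne_zero.2 h1.symm
  have h := (convex_Icc y (y + 1)).norm_image_sub_le_of_norm_hasDerivWithin_le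
    (f := fun x : ℝ => (x : ℂ) ^ (1 - s) - (1 - s) * (x * (y : ℂ) ^ (-s)))
    (f' := fun x : ℝ => (1 - s) * ((x : ℂ) ^ (-s) - (y : ℂ) ^ (-s)))
    (C := ‖s - 1‖ * (‖s‖ * y ^ (-s.re - 1))) (x := y) (y := y + 1) ?_ ?_
    ⟨le_rfl, by linarith⟩ ⟨by linarith, le_rfl⟩
  · have e : zetaTelescope n s = ((y + 1 : ℝ) : ℂ) ^ (1 - s)
        - (1 - s) * ((y + 1 : ℝ) * (y : ℂ) ^ (-s))
        - ((y : ℂ) ^ (1 - s) - (1 - s) * (y * (y : ℂ) ^ (-s))) := by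
      have : (n + 2 : ℝ) = y + 1 := by rw [hy]; ring
      rw [zetaTelescope, this, ← hy]
      push_cast
      ring
    rw [e]
    refine h.trans ?_
    simp
  · intro u hu
    have hu0 : 0 < u := hy0.trans_le hu.1
    have d1 := hasDerivAt_ofReal_cpow_const hu0.ne' hs0
    have d2 : HasDerivAt (fun x : ℝ => (1 - s) * ((x : ℂ) * (y : ℂ) ^ (-s)))
        ((1 - s) * (1 * (y : ℂ) ^ (-s))) u :=
      ((hasDerivAt_id u).ofReal_comp.mul_const _).const_mul _
    have d3 := (d1.sub d2).hasDerivWithinAt (s := Set.Icc y (y + 1))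
    refine d3.congr_deriv ?_
    rw [show 1 - s - 1 = -s by ring]
    ring
  · intro u hu
    rw [norm_mul, norm_sub_rev]
    gcongr
    exact norm_cpow_neg_sub_cpow_neg_le hy0 hs hu

lemma differentiable_zetaTelescope (n : ℕ) : Differentiable ℂ (zetaTelescope n) := by
  unfold zetaTelescope
  have h1 : ((n + 1 : ℝ) : ℂ) ≠ 0 := by
    exact_mod_cast (by positivity : (n + 1 : ℝ) ≠ 0)
  have h2 : ((n + 2 : ℝ) : ℂ) ≠ 0 := by
    exact_mod_cast (by positivity : (n + 2 : ℝ) ≠ 0)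
  have a1 : Differentiable ℂ fun s : ℂ => ((n + 1 : ℝ) : ℂ) ^ (-s) :=
    differentiable_neg.const_cpow (Or.inl h1)
  have a2 : Differentiable ℂ fun s : ℂ => ((n + 2 : ℝ) : ℂ) ^ (1 - s) :=
    ((differentiable_const _).sub differentiable_id).const_cpow (Or.inl h2)
  have a3 : Differentiable ℂ fun s : ℂ => ((n + 1 : ℝ) : ℂ) ^ (1 - s) :=
    ((differentiable_const _).sub differentiable_id).const_cpow (Or.inl h1)
  exact (((differentiable_id.sub (differentiable_const _)).mul a1).add a2).sub a3

lemma summable_nat_add_one_rpow {p : ℝ} (hp : p < -1) :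
    Summable fun n : ℕ => (n + 1 : ℝ) ^ p := by
  have := (summable_nat_add_iff 1).2 (Real.summable_nat_rpow.2 hp)
  simpa using this

lemma summable_zetaTelescope {s : ℂ} (hs : 0 < s.re) : Summable fun n => zetaTelescope n s :=
  Summable.of_norm_bounded
    (((summable_nat_add_one_rpow (p := -s.re - 1) (by linarith)).mul_left _).mul_left _)
    fun n => norm_zetaTelescope_le n hs

lemma sum_zetaTelescope (N : ℕ) (s : ℂ) :
    ∑ n ∈ range N, zetaTelescope n s =
      (s - 1) * (∑ n ∈ range N, 1 / ((n : ℂ) + 1) ^ s) + ((N + 1 : ℝ) : ℂ) ^ (1 - s) - 1 := by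
  induction N with
  | zero => simp
  | succ N ih =>
    rw [sum_range_succ, sum_range_succ, ih, zetaTelescope]
    have : ((N + 1 : ℕ) + 1 : ℝ) = N + 2 := by push_cast; ring
    rw [this, cpow_neg]
    push_cast
    ring

lemma riemannZeta₁_eq_tsum_of_one_lt_re {s : ℂ} (hs : 1 < s.re) :
    riemannZeta₁ s = 1 + ∑' n, zetaTelescope n s := by
  have h1 : s ≠ 1 := by rintro rfl; simp at hs
  have hz : riemannZeta₁ s = (s - 1) * riemannZeta s := by
    rw [riemannZeta_eq_inv_sub_mul h1, mul_inv_cancel_left₀ (sub_ne_zero.2 h1)]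
  have hsum : Summable fun n : ℕ => 1 / ((n : ℂ) + 1) ^ s := by
    have := (summable_nat_add_iff 1).2 (summable_one_div_nat_cpow.2 hs)
    simpa using this
  have t1 := hsum.hasSum.tendsto_sum_nat
  have t2 := (summable_zetaTelescope (by linarith : 0 < s.re)).hasSum.tendsto_sum_nat
  have t3 : Filter.Tendsto (fun N : ℕ => ((N + 1 : ℝ) : ℂ) ^ (1 - s)) Filter.atTop (nhds 0) := by
    rw [tendsto_zero_iff_norm_tendsto_zero]
    have : (fun N : ℕ => ‖((N + 1 : ℝ) : ℂ) ^ (1 - s)‖) = fun N : ℕ => (N + 1 : ℝ) ^ (-(s.re - 1)) := by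
      funext N
      rw [norm_cpow_eq_rpow_re_of_pos (by positivity)]
      simp
    rw [this]
    exact (tendsto_rpow_neg_atTop (by linarith : 0 < s.re - 1)).comp
      (Filter.tendsto_atTop_add_const_right _ 1 tendsto_natCast_atTop_atTop)
  have t4 := ((t1.const_mul (s - 1)).add t3).sub_const 1
  have := tendsto_nhds_unique t2 (t4.congr fun N => (sum_zetaTelescope N s).symm)
  rw [this, hz, zeta_eq_tsum_one_div_nat_add_one_cpow hs]
  ring

lemma riemannZeta₁_eq_tsum {s : ℂ} (hs : 1 / 4 ≤ s.re) :
    riemannZeta₁ s = 1 + ∑' n, zetaTelescope n s := by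
  set R : ℝ := ‖s‖ + 3 with hR
  set U : Set ℂ := {w | 1 / 8 < w.re} ∩ Metric.ball 0 R with hU
  have hUo : IsOpen U := (isOpen_lt continuous_const continuous_re).inter Metric.isOpen_ball
  have hUc : IsPreconnected U :=
    ((convex_halfSpace_re_gt _).inter (convex_ball _ _)).isPreconnected
  have hd : DifferentiableOn ℂ (fun w => ∑' n, zetaTelescope n w) U := by
    refine differentiableOn_tsum_of_summable_norm
      (u := fun n : ℕ => (R + 1) * (R * (n + 1 : ℝ) ^ (-(9 / 8) : ℝ)))
      (((summable_nat_add_one_rpow (by norm_num)).mul_left _).mul_left _)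
      (fun n => (differentiable_zetaTelescope n).differentiableOn) hUo ?_
    intro n w hw
    have hw1 : 1 / 8 < w.re := hw.1
    have hw2 : ‖w‖ ≤ R := by simpa using (Metric.mem_ball.1 hw.2).le
    refine (norm_zetaTelescope_le n (by linarith)).trans ?_
    have : ‖w - 1‖ ≤ R + 1 := (norm_sub_le _ _).trans (by simpa using hw2)
    gcongr
    · have : (0 : ℝ) ≤ n := n.cast_nonneg
      linarith
    · linarith
  have h1 : AnalyticOnNhd ℂ riemannZeta₁ U :=
    differentiable_riemannZeta₁.differentiableOn.analyticOnNhd hUo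
  have h2 : AnalyticOnNhd ℂ (fun w => 1 + ∑' n, zetaTelescope n w) U :=
    ((differentiableOn_const 1).add hd).analyticOnNhd hUo
  have h2U : (2 : ℂ) ∈ U := by
    refine ⟨by norm_num [Set.mem_ofPred_eq], ?_⟩
    rw [Metric.mem_ball, dist_zero_right]
    norm_num
    have := norm_nonneg s
    linarith
  refine h1.eqOn_of_preconnected_of_eventuallyEq h2 hUc h2U ?_ ⟨?_, ?_⟩
  · filter_upwards [(isOpen_lt continuous_const continuous_re).mem_nhds
      (show (1 : ℝ) < (2 : ℂ).re by norm_num)] with w hw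
    exact riemannZeta₁_eq_tsum_of_one_lt_re hw
  · simp only [Set.mem_ofPred_eq]; linarith
  · simp [hR]

theorem exists_norm_riemannZeta₁_le :
    ∃ C > 0, ∀ s : ℂ, 1 / 4 ≤ s.re → ‖riemannZeta₁ s‖ ≤ C * (1 + ‖s‖) ^ 2 := by
  set S : ℝ := ∑' n : ℕ, (n + 1 : ℝ) ^ (-(5 / 4) : ℝ) with hS
  have hsum : Summable fun n : ℕ => (n + 1 : ℝ) ^ (-(5 / 4) : ℝ) :=
    summable_nat_add_one_rpow (by norm_num)
  have hS0 : 0 ≤ S := tsum_nonneg fun n => by positivity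
  refine ⟨1 + S, by positivity, fun s hs => ?_⟩
  have hb : ‖∑' n, zetaTelescope n s‖ ≤ ‖s - 1‖ * (‖s‖ * S) := by
    refine tsum_of_norm_bounded (((hsum.hasSum).mul_left _).mul_left _) fun n => ?_
    refine (norm_zetaTelescope_le n (by linarith)).trans ?_
    gcongr
    · have : (0 : ℝ) ≤ n := n.cast_nonneg
      linarith
    · linarith
  rw [riemannZeta₁_eq_tsum hs]
  have h1 : ‖s - 1‖ ≤ 1 + ‖s‖ := (norm_sub_le _ _).trans (by simp [add_comm])
  have h0 := norm_nonneg s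
  calc ‖1 + ∑' n, zetaTelescope n s‖ ≤ 1 + ‖s - 1‖ * (‖s‖ * S) := by
        refine (norm_add_le _ _).trans ?_
        simpa using hb
    _ ≤ 1 * (1 + ‖s‖) ^ 2 + (1 + ‖s‖) * ((1 + ‖s‖) * S) := by
        gcongr
        · nlinarith
        · linarith
    _ = (1 + S) * (1 + ‖s‖) ^ 2 := by ring

lemma riemannZeta₁_eq_mul {s : ℂ} (hs : s ≠ 1) : riemannZeta₁ s = (s - 1) * riemannZeta s := by
  rw [riemannZeta_eq_inv_sub_mul hs, mul_inv_cancel_left₀ (sub_ne_zero.2 hs)]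

lemma norm_Gamma_le_Gamma_re {s : ℂ} (hs : 0 < s.re) : ‖Gamma s‖ ≤ Real.Gamma s.re := by
  rw [Gamma_eq_integral hs, Real.Gamma_eq_integral hs, GammaIntegral]
  refine (MeasureTheory.norm_integral_le_integral_norm _).trans (le_of_eq ?_)
  refine MeasureTheory.setIntegral_congr_fun measurableSet_Ioi fun x hx => ?_
  simp only [norm_mul]
  rw [norm_cpow_eq_rpow_re_of_pos hx, norm_real, Real.norm_eq_abs, Real.abs_exp]
  simp

lemma norm_Gamma_half_add_mul_I_sq_le (y : ℝ) :
    ‖Gamma (1 / 2 + y * I)‖ ^ 2 ≤ 2 * Real.pi * Real.exp (-(Real.pi * |y|)) := by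
  have h := Complex.Gamma_mul_Gamma_one_sub (1 / 2 + y * I)
  have e1 : 1 - (1 / 2 + y * I) = (starRingEnd ℂ) (1 / 2 + y * I) := by
    apply Complex.ext <;> simp
    norm_num
  have e2 : sin (Real.pi * (1 / 2 + y * I)) = ((Real.cosh (Real.pi * y) : ℝ) : ℂ) := by
    rw [show (Real.pi : ℂ) * (1 / 2 + y * I) = (Real.pi * y : ℝ) * I + Real.pi / 2 by
      push_cast; ring]
    rw [Complex.sin_add_pi_div_two, Complex.cos_mul_I, ofReal_cosh]
  rw [e1, Gamma_conj, e2] at h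
  have h2 := congrArg norm h
  rw [norm_mul, Complex.norm_conj, norm_div, norm_real, norm_real, Real.norm_eq_abs, Real.norm_eq_abs,
    abs_of_pos Real.pi_pos, abs_of_pos (Real.cosh_pos _)] at h2
  rw [sq, h2, div_le_iff₀ (Real.cosh_pos _)]
  have h3 : Real.exp (Real.pi * |y|) / 2 ≤ Real.cosh (Real.pi * y) := by
    rw [← Real.cosh_abs, abs_mul, abs_of_pos Real.pi_pos, Real.cosh_eq]
    have := Real.exp_pos (-(Real.pi * |y|))
    linarith
  calc Real.pi = 2 * Real.pi * Real.exp (-(Real.pi * |y|)) * (Real.exp (Real.pi * |y|) / 2) := by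
        rw [Real.exp_neg]; field_simp
    _ ≤ _ := by gcongr

lemma norm_Gamma_one_add_mul_I_sq_le (y : ℝ) :
    ‖Gamma (1 + y * I)‖ ^ 2 ≤
      (Real.exp Real.pi + 4 * Real.pi) * (1 + |y|) * Real.exp (-(Real.pi * |y|)) := by
  have hpi := Real.pi_pos
  rcases le_or_gt |y| 1 with hy | hy
  · have h1 : ‖Gamma (1 + y * I)‖ ≤ 1 := by
      have := norm_Gamma_le_Gamma_re (s := 1 + y * I) (by simp)
      simpa using this
    calc ‖Gamma (1 + y * I)‖ ^ 2 ≤ 1 := pow_le_one₀ (norm_nonneg _) h1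
      _ = Real.exp Real.pi * 1 * Real.exp (-(Real.pi * 1)) := by
        rw [mul_one, mul_one, ← Real.exp_add]; simp
      _ ≤ _ := by
        gcongr
        · linarith
        · linarith [abs_nonneg y]
  · have hy0 : (y : ℂ) * I ≠ 0 := by
      have : y ≠ 0 := by rintro rfl; norm_num at hy
      simp [this]
    have h := Complex.Gamma_mul_Gamma_one_sub (y * I)
    have e1 : 1 - (y * I : ℂ) = (starRingEnd ℂ) (1 + y * I) := by
      apply Complex.ext <;> simp
    have e2 : sin (Real.pi * (y * I)) = ((Real.sinh (Real.pi * y) : ℝ) : ℂ) * I := by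
      rw [show (Real.pi : ℂ) * (y * I) = (Real.pi * y : ℝ) * I by push_cast; ring]
      rw [Complex.sin_mul_I, ofReal_sinh]
    have e3 : Gamma (1 + y * I) = y * I * Gamma (y * I) := by
      rw [add_comm, Gamma_add_one _ hy0]
    have h2 : ‖Gamma (1 + y * I)‖ ^ 2 = |y| * (Real.pi / |Real.sinh (Real.pi * y)|) := by
      calc ‖Gamma (1 + y * I)‖ ^ 2
          = ‖Gamma (1 + y * I)‖ * ‖(starRingEnd ℂ) (Gamma (1 + y * I))‖ := by
            rw [Complex.norm_conj, sq]
        _ = ‖y * I * (Gamma (y * I) * Gamma (1 - y * I))‖ := by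
            rw [← Gamma_conj, ← e1, e3, ← norm_mul]; ring_nf
        _ = _ := by
            rw [h, e2]
            rw [norm_mul, norm_mul, norm_div, norm_mul, norm_I, norm_real, norm_real, norm_real,
              Real.norm_eq_abs, Real.norm_eq_abs, Real.norm_eq_abs, abs_of_pos hpi, mul_one, mul_one]
    rw [h2]
    have h3 : Real.exp (Real.pi * |y|) / 4 ≤ |Real.sinh (Real.pi * y)| := by
      rw [Real.abs_sinh, abs_mul, abs_of_pos hpi, Real.sinh_eq]
      have a1 : Real.exp (-(Real.pi * |y|)) ≤ 1 := Real.exp_le_one_iff.2 (by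
        have := abs_nonneg y; have := mul_nonneg hpi.le this; linarith)
      have a2 : 2 ≤ Real.exp (Real.pi * |y|) := by
        have : 1 ≤ Real.pi * |y| := by nlinarith [Real.pi_gt_three]
        linarith [Real.add_one_le_exp (Real.pi * |y|)]
      linarith
    calc |y| * (Real.pi / |Real.sinh (Real.pi * y)|)
        ≤ |y| * (Real.pi / (Real.exp (Real.pi * |y|) / 4)) := by gcongr
      _ = (4 * Real.pi) * |y| * Real.exp (-(Real.pi * |y|)) := by
        rw [Real.exp_neg]; field_simp
      _ ≤ _ := by
        gcongr
        · linarith [Real.exp_pos Real.pi]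
        · linarith

lemma Gamma_bounded_of_re_mem_Icc {a b : ℝ} (ha : 0 < a) :
    ∃ C, ∀ s : ℂ, s.re ∈ Set.Icc a b → ‖Gamma s‖ ≤ C := by
  have hc : ContinuousOn Real.Gamma (Set.Icc a b) := fun x hx =>
    (Real.differentiableAt_Gamma fun m => by
      have : (0 : ℝ) ≤ m := m.cast_nonneg
      have := hx.1
      linarith).continuousAt.continuousWithinAt
  obtain ⟨C, hC⟩ := isCompact_Icc.exists_bound_of_continuousOn hc
  refine ⟨C, fun s hs => (norm_Gamma_le_Gamma_re (ha.trans_le hs.1)).trans ?_⟩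
  exact (le_abs_self _).trans (hC _ hs)

/-- Upper Stirling bound for `Γ` inside the strip `1/2 ≤ Re s ≤ 1`. -/
theorem exists_norm_Gamma_le {δ : ℝ} (hδ : 0 < δ) (hδ' : δ ≤ 1 / 2) :
    ∃ C > 0, ∀ t : ℝ, 0 ≤ t → ‖Gamma ((1 / 2 + δ : ℝ) + t * I)‖ ≤
      C * (1 + t) ^ δ * Real.exp (-(Real.pi * t / 2)) := by
  have hpi := Real.pi_pos
  set A : ℝ := Real.sqrt (2 * Real.pi) * Real.exp 1 with hA
  set B : ℝ := Real.sqrt ((Real.exp Real.pi + 4 * Real.pi) * 2) * Real.exp 1 with hB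
  have hA0 : 0 < A := by positivity
  have hB0 : 0 < B := by positivity
  refine ⟨A ^ (1 - 2 * δ) * B ^ (2 * δ), by positivity, fun t ht => ?_⟩
  set E : ℝ := Real.exp (-(Real.pi * t / 2)) with hE
  have hE0 : 0 < E := Real.exp_pos _
  set f : ℂ → ℂ := fun w => Gamma (w + t * I) * exp (-(I * (Real.pi / 2 : ℝ) * w) + w ^ 2) with hf
  have hnorm : ∀ w : ℂ, ‖f w‖ =
      ‖Gamma (w + t * I)‖ * Real.exp (Real.pi / 2 * w.im + (w.re ^ 2 - w.im ^ 2)) := by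
    intro w
    simp only [hf, norm_mul, norm_exp]
    congr 2
    simp [sq]
  have hre : ∀ w : ℂ, (w + t * I).re = w.re := by intro w; simp
  have key := HadamardThreeLines.norm_le_interp_of_mem_verticalClosedStrip' (f := f)
    (z := ((1 / 2 + δ : ℝ) : ℂ)) (a := A * E) (b := B * (1 + t) ^ (1 / 2 : ℝ) * E)
    (l := 1 / 2) (u := 1) (by norm_num) ?_ ?_ ?_ ?_ ?_
  · rw [hnorm] at key
    simp only [ofReal_re, ofReal_im] at key
    have e0 : (1 / 2 + δ - 1 / 2) / (1 - 1 / 2) = 2 * δ := by ring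
    rw [e0, Real.mul_rpow hA0.le hE0.le, Real.mul_rpow (by positivity) hE0.le,
      Real.mul_rpow hB0.le (by positivity), ← Real.rpow_mul (by positivity)] at key
    have e1 : E ^ (1 - 2 * δ) * E ^ (2 * δ) = E := by
      rw [← Real.rpow_add hE0]; simp
    have e2 : (1 / 2 : ℝ) * (2 * δ) = δ := by ring
    rw [e2] at key
    calc ‖Gamma ((1 / 2 + δ : ℝ) + t * I)‖
        ≤ ‖Gamma ((1 / 2 + δ : ℝ) + t * I)‖ *
          Real.exp (Real.pi / 2 * 0 + ((1 / 2 + δ) ^ 2 - 0 ^ 2)) := by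
          refine le_mul_of_one_le_right (norm_nonneg _) (Real.one_le_exp ?_)
          nlinarith
      _ ≤ _ := key
      _ = A ^ (1 - 2 * δ) * B ^ (2 * δ) * (1 + t) ^ δ * (E ^ (1 - 2 * δ) * E ^ (2 * δ)) := by ring
      _ = _ := by rw [e1]
  · simp only [HadamardThreeLines.verticalClosedStrip, Set.mem_preimage, ofReal_re]
    constructor <;> linarith
  · have hd : ∀ w : ℂ, 0 < w.re → DifferentiableAt ℂ f w := by
      intro w hw
      have h1 : DifferentiableAt ℂ Gamma (w + t * I) := by
        refine differentiableAt_Gamma _ fun m h => ?_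
        have := congrArg re h
        rw [hre] at this
        simp at this
        have h2 : (0 : ℝ) ≤ m := m.cast_nonneg
        linarith
      have h2 : DifferentiableAt ℂ (fun w : ℂ => Gamma (w + t * I)) w :=
        h1.comp w (by fun_prop)
      exact h2.mul (by fun_prop)
    refine DifferentiableOn.diffContOnCl fun w hw => ?_
    refine (hd w ?_).differentiableWithinAt
    have : w ∈ closure (re ⁻¹' Set.Ioo (1 / 2 : ℝ) 1) := hw
    have h2 := closure_minimal (s := re ⁻¹' Set.Ioo (1 / 2 : ℝ) 1) (t := re ⁻¹' Set.Icc (1 / 2 : ℝ) 1)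
      (Set.preimage_mono Set.Ioo_subset_Icc_self) (isClosed_Icc.preimage continuous_re) this
    have := h2.1
    linarith
  · obtain ⟨C, hC⟩ := Gamma_bounded_of_re_mem_Icc (a := 1 / 2) (b := 1) (by norm_num)
    refine ⟨C * Real.exp (Real.pi ^ 2 + 1), ?_⟩
    rintro _ ⟨w, hw, rfl⟩
    have hw' : w.re ∈ Set.Icc (1 / 2 : ℝ) 1 := hw
    simp only [Function.comp]
    rw [hnorm]
    have h1 := hC (w + t * I) (by rw [hre]; exact hw')
    have hC0 := (norm_nonneg _).trans h1
    have h2 := hw'.1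
    have h3 := hw'.2
    refine mul_le_mul h1 (Real.exp_le_exp.2 ?_) (Real.exp_nonneg _) hC0
    nlinarith [sq_nonneg (Real.pi / 2 - 2 * w.im), sq_nonneg (Real.pi - w.im)]
  · intro w hw
    have hw' : w.re = 1 / 2 := hw
    rw [hnorm]
    have e : w + t * I = 1 / 2 + ((w.im + t : ℝ) : ℂ) * I := by
      apply Complex.ext <;> simp [hw']
    have h1 : ‖Gamma (w + t * I)‖ ≤
        Real.sqrt (2 * Real.pi) * Real.exp (-(Real.pi * (w.im + t) / 2)) := by
      rw [e]
      refine le_of_sq_le_sq ((norm_Gamma_half_add_mul_I_sq_le _).trans ?_) (by positivity)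
      rw [mul_pow, Real.sq_sqrt (by positivity), ← Real.exp_nat_mul]
      gcongr
      push_cast
      nlinarith [le_abs_self (w.im + t)]
    calc _ ≤ Real.sqrt (2 * Real.pi) * Real.exp (-(Real.pi * (w.im + t) / 2)) *
          Real.exp (Real.pi / 2 * w.im + (w.re ^ 2 - w.im ^ 2)) := by gcongr
      _ = Real.sqrt (2 * Real.pi) * Real.exp (w.re ^ 2 - w.im ^ 2 + -(Real.pi * t / 2)) := by
          rw [mul_assoc, ← Real.exp_add]; ring_nf
      _ ≤ Real.sqrt (2 * Real.pi) * Real.exp (1 + -(Real.pi * t / 2)) := by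
          gcongr
          rw [hw']; nlinarith [sq_nonneg w.im]
      _ = A * E := by rw [Real.exp_add, hA, hE]; ring
  · intro w hw
    have hw' : w.re = 1 := hw
    rw [hnorm]
    have e : w + t * I = 1 + ((w.im + t : ℝ) : ℂ) * I := by
      apply Complex.ext <;> simp [hw']
    have habs : 1 + |w.im + t| ≤ (1 + t) * (2 * Real.exp (2 * w.im ^ 2)) := by
      have h1 : |w.im + t| ≤ |w.im| + t := (abs_add_le _ _).trans (by rw [abs_of_nonneg ht])
      have h2 := Real.add_one_le_exp (2 * w.im ^ 2)
      have h3 : 1 + |w.im| ≤ 2 * Real.exp (2 * w.im ^ 2) := by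
        nlinarith [sq_abs w.im, sq_nonneg (|w.im| - 1)]
      nlinarith [abs_nonneg w.im, mul_le_mul_of_nonneg_left h3 (by linarith : 0 ≤ 1 + t)]
    have h1 : ‖Gamma (w + t * I)‖ ≤
        Real.sqrt ((Real.exp Real.pi + 4 * Real.pi) * 2) * (1 + t) ^ (1 / 2 : ℝ) *
          Real.exp (w.im ^ 2) * Real.exp (-(Real.pi * (w.im + t) / 2)) := by
      rw [e]
      refine le_of_sq_le_sq ((norm_Gamma_one_add_mul_I_sq_le _).trans ?_) (by positivity)
      rw [mul_pow, mul_pow, mul_pow, Real.sq_sqrt (by positivity), ← Real.exp_nat_mul,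
        ← Real.exp_nat_mul, ← Real.rpow_natCast, ← Real.rpow_mul (by positivity)]
      have e3 : (1 + t) ^ ((1 / 2 : ℝ) * (2 : ℕ)) = 1 + t := by norm_num
      rw [e3]
      calc _ ≤ (Real.exp Real.pi + 4 * Real.pi) * ((1 + t) * (2 * Real.exp (2 * w.im ^ 2))) *
            Real.exp (-(Real.pi * (w.im + t))) := by
              gcongr
              exact le_abs_self _
        _ = _ := by push_cast; ring_nf
    calc _ ≤ Real.sqrt ((Real.exp Real.pi + 4 * Real.pi) * 2) * (1 + t) ^ (1 / 2 : ℝ) *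
          Real.exp (w.im ^ 2) * Real.exp (-(Real.pi * (w.im + t) / 2)) *
          Real.exp (Real.pi / 2 * w.im + (w.re ^ 2 - w.im ^ 2)) := by gcongr
      _ = Real.sqrt ((Real.exp Real.pi + 4 * Real.pi) * 2) * (1 + t) ^ (1 / 2 : ℝ) *
          (Real.exp (w.im ^ 2) * Real.exp (-(Real.pi * (w.im + t) / 2)) *
          Real.exp (Real.pi / 2 * w.im + (w.re ^ 2 - w.im ^ 2))) := by ring
      _ = Real.sqrt ((Real.exp Real.pi + 4 * Real.pi) * 2) * (1 + t) ^ (1 / 2 : ℝ) *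
          (Real.exp 1 * E) := by
          rw [hE, ← Real.exp_add, ← Real.exp_add, ← Real.exp_add, hw']; ring_nf
      _ = _ := by rw [hB]; ring

lemma norm_cos_le_exp_abs_im (w : ℂ) : ‖cos w‖ ≤ Real.exp |w.im| := by
  have h : ‖2 * cos w‖ ≤ Real.exp |w.im| + Real.exp |w.im| := by
    rw [two_cos]
    refine (norm_add_le _ _).trans ?_
    rw [norm_exp, norm_exp]
    gcongr
    · simpa using neg_le_abs w.im
    · simpa using le_abs_self w.im
  rw [norm_mul] at h
  norm_num at h
  linarith

/-- The functional equation turned into a size comparison of `ζ` on the lines `1/2 ± δ`. -/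
theorem exists_norm_riemannZeta_reflect_le {δ : ℝ} (hδ : 0 < δ) (hδ' : δ ≤ 1 / 4) :
    ∃ C > 0, ∀ t : ℝ, 0 ≤ t → ‖riemannZeta ((1 / 2 - δ : ℝ) + t * I)‖ ≤
      C * (1 + t) ^ δ * ‖riemannZeta ((1 / 2 + δ : ℝ) + t * I)‖ := by
  obtain ⟨C, hC, h⟩ := exists_norm_Gamma_le hδ (by linarith)
  refine ⟨2 * C, by positivity, fun t ht => ?_⟩
  set s : ℂ := (1 / 2 + δ : ℝ) + t * I with hs
  have hsre : s.re = 1 / 2 + δ := by simp [hs]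
  have hsim : s.im = t := by simp [hs]
  have e : ((1 / 2 - δ : ℝ) : ℂ) + t * I = (starRingEnd ℂ) (1 - s) := by
    apply Complex.ext <;> simp [hs]
    ring
  rw [e, riemannZeta_conj, Complex.norm_conj, riemannZeta_one_sub]
  · simp only [norm_mul]
    have h1 : ‖(2 * (Real.pi : ℂ)) ^ (-s)‖ ≤ 1 := by
      rw [show (2 * (Real.pi : ℂ)) = ((2 * Real.pi : ℝ) : ℂ) by push_cast; rfl,
        norm_cpow_eq_rpow_re_of_pos (by positivity)]
      refine Real.rpow_le_one_of_one_le_of_nonpos ?_ ?_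
      · linarith [Real.pi_gt_three]
      · rw [neg_re, hsre]; linarith
    have h2 : ‖cos (Real.pi * s / 2)‖ ≤ Real.exp (Real.pi * t / 2) := by
      refine (norm_cos_le_exp_abs_im _).trans (le_of_eq ?_)
      congr 1
      have : (Real.pi * s / 2 : ℂ).im = Real.pi * t / 2 := by
        rw [show (Real.pi * s / 2 : ℂ) = ((Real.pi / 2 : ℝ) : ℂ) * s by push_cast; ring,
          im_ofReal_mul, hsim]
        ring
      rw [this, abs_of_nonneg (by have := Real.pi_pos; positivity)]
    have h3 := h t ht
    calc ‖(2 : ℂ)‖ * ‖(2 * (Real.pi : ℂ)) ^ (-s)‖ * ‖Gamma s‖ * ‖cos (Real.pi * s / 2)‖ *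
          ‖riemannZeta s‖
        ≤ 2 * 1 * (C * (1 + t) ^ δ * Real.exp (-(Real.pi * t / 2))) *
          Real.exp (Real.pi * t / 2) * ‖riemannZeta s‖ := by
          gcongr
          simp
      _ = 2 * C * (1 + t) ^ δ * (Real.exp (-(Real.pi * t / 2)) *
          Real.exp (Real.pi * t / 2)) * ‖riemannZeta s‖ := by ring
      _ = _ := by rw [← Real.exp_add]; simp
  · intro n hn
    have := congrArg re hn
    rw [hsre] at this
    simp at this
    have h2 : (0 : ℝ) ≤ n := n.cast_nonneg
    linarith
  · intro hn
    have := congrArg re hn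
    rw [hsre] at this
    simp at this
    linarith

lemma norm_integral_exp_mul_I_le {l : ℝ} (hl : l ≠ 0) (A B : ℝ) :
    ‖∫ t in A..B, exp (((t * l : ℝ) : ℂ) * I)‖ ≤ 2 / |l| := by
  have hc : (l : ℂ) * I ≠ 0 := by simp [hl]
  have e : (fun t : ℝ => exp (((t * l : ℝ) : ℂ) * I)) = fun t : ℝ => exp ((l * I) * t) := by
    funext t; push_cast; ring_nf
  rw [e, integral_exp_mul_complex hc, norm_div]
  have h1 : ∀ t : ℝ, ‖exp (l * I * t)‖ = 1 := by
    intro t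
    rw [show (l * I * t : ℂ) = ((l * t : ℝ) : ℂ) * I by push_cast; ring, norm_exp_ofReal_mul_I]
  have h2 : ‖(l : ℂ) * I‖ = |l| := by simp
  rw [h2]
  gcongr
  refine (norm_sub_le _ _).trans ?_
  rw [h1, h1]; norm_num

lemma one_div_abs_log_sub_log_le {m n : ℕ} (hm : 1 ≤ m) (hn : 1 ≤ n) (hmn : m ≠ n) :
    1 / |Real.log m - Real.log n| ≤ 1 + Real.sqrt m * Real.sqrt n / |(m : ℝ) - n| := by
  wlog h : n < m generalizing m n with H
  · have := H hn hm hmn.symm (by omega)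
    rwa [abs_sub_comm, abs_sub_comm (m : ℝ), mul_comm (Real.sqrt m)]
  have hn0 : (0 : ℝ) < n := by exact_mod_cast hn
  have hm0 : (0 : ℝ) < m := by exact_mod_cast hm
  have hlt : (n : ℝ) < m := by exact_mod_cast h
  have hlog : ((m : ℝ) - n) / m ≤ Real.log m - Real.log n := by
    rw [← Real.log_div hm0.ne' hn0.ne']
    have := Real.one_sub_inv_le_log_of_pos (div_pos hm0 hn0)
    rw [inv_div] at this
    rwa [sub_div, div_self hm0.ne']
  have hpos : 0 < ((m : ℝ) - n) / m := div_pos (by linarith) hm0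
  rw [abs_of_pos (hpos.trans_le hlog), abs_of_pos (by linarith : (0 : ℝ) < m - n)]
  have h1 : (n : ℝ) ≤ Real.sqrt m * Real.sqrt n := by
    nth_rewrite 1 [← Real.mul_self_sqrt hn0.le]
    gcongr
  calc 1 / (Real.log m - Real.log n) ≤ 1 / (((m : ℝ) - n) / m) :=
        one_div_le_one_div_of_le hpos hlog
    _ = 1 + n / ((m : ℝ) - n) := by
        have : (m : ℝ) - n ≠ 0 := by linarith
        field_simp
        ring
    _ ≤ _ := by
        have : (0 : ℝ) < m - n := by linarith
        gcongr

lemma sum_one_div_abs_sub_le {N : ℕ} {S : Finset ℕ} (hS : ∀ n ∈ S, 1 ≤ n ∧ n ≤ N) {m : ℕ}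
    (hm : m ∈ S) :
    ∑ n ∈ S with n ≠ m, 1 / |(m : ℝ) - n| ≤ 2 * (1 + Real.log N) := by
  have hH : ∑ k ∈ Icc 1 N, 1 / (k : ℝ) ≤ 1 + Real.log N := by
    have := harmonic_le_one_add_log N
    rw [harmonic_eq_sum_Icc] at this
    push_cast at this
    simpa using this
  have hsplit : S.filter (· ≠ m) ⊆ S.filter (· < m) ∪ S.filter (m < ·) := by
    intro n hn
    simp only [mem_filter, mem_union] at hn ⊢
    rcases lt_or_gt_of_ne hn.2 with h | h
    · exact Or.inl ⟨hn.1, h⟩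
    · exact Or.inr ⟨hn.1, h⟩
  have key : ∀ (P : ℕ → Prop) [DecidablePred P] (g : ℕ → ℕ), (∀ n ∈ S, P n → 1 ≤ g n ∧ g n ≤ N) →
      (∀ n ∈ S, P n → |(m : ℝ) - n| = g n) →
      (∀ n ∈ S, P n → ∀ k ∈ S, P k → g n = g k → n = k) →
      ∑ n ∈ S with P n, 1 / |(m : ℝ) - n| ≤ 1 + Real.log N := by
    intro P _ g h1 h2 h3
    have e : ∑ n ∈ S with P n, 1 / |(m : ℝ) - n| = ∑ k ∈ (S.filter P).image g, 1 / (k : ℝ) := by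
      rw [sum_image]
      · refine sum_congr rfl fun n hn => ?_
        rw [mem_filter] at hn
        rw [h2 n hn.1 hn.2]
      · intro n hn k hk hnk
        rw [mem_coe, mem_filter] at hn hk
        exact h3 n hn.1 hn.2 k hk.1 hk.2 hnk
    rw [e]
    refine (sum_le_sum_of_subset_of_nonneg ?_ fun _ _ _ => by positivity).trans hH
    intro k hk
    obtain ⟨n, hn, rfl⟩ := mem_image.1 hk
    rw [mem_filter] at hn
    exact mem_Icc.2 (h1 n hn.1 hn.2)
  have hmN := hS m hm
  have k1 := key (· < m) (fun n => m - n) (fun n hn h => by have := hS n hn; omega)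
    (fun n hn h => by
      rw [Nat.cast_sub (by omega), abs_of_nonneg]
      have : (n : ℝ) < m := by exact_mod_cast h
      linarith) (fun n hn h k hk h' e => by 
      have e' : m - n = m - k := e; have := hS n hn; have := hS k hk; omega)
  have k2 := key (m < ·) (fun n => n - m) (fun n hn h => by have := hS n hn; omega)
    (fun n hn h => by
      rw [Nat.cast_sub (by omega), abs_of_nonpos]
      · ring
      · have : (m : ℝ) < n := by exact_mod_cast h
        linarith) (fun n hn h k hk h' e => by 
      have e' : n - m = k - m := e; have := hS n hn; have := hS k hk; omega)
  calc ∑ n ∈ S with n ≠ m, 1 / |(m : ℝ) - n|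
      ≤ ∑ n ∈ S.filter (· < m) ∪ S.filter (m < ·), 1 / |(m : ℝ) - n| :=
        sum_le_sum_of_subset_of_nonneg hsplit fun _ _ _ => by positivity
    _ ≤ ∑ n ∈ S with n < m, 1 / |(m : ℝ) - n| + ∑ n ∈ S with m < n, 1 / |(m : ℝ) - n| := by
        have := sum_union_inter (s₁ := S.filter (· < m)) (s₂ := S.filter (m < ·))
          (f := fun n : ℕ => 1 / |(m : ℝ) - n|)
        rw [← this]
        exact le_add_of_nonneg_right (sum_nonneg fun _ _ => by positivity)
    _ ≤ _ := by linarith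

/-- Mean value theorem for trigonometric sums with frequencies `log n`. -/
theorem integral_norm_sum_exp_log_sq_le {N : ℕ} {S : Finset ℕ} (hS : ∀ n ∈ S, 1 ≤ n ∧ n ≤ N)
    (a : ℕ → ℂ) {A B : ℝ} (hAB : A ≤ B) :
    ∫ t in A..B, ‖∑ n ∈ S, a n * exp (((t * Real.log n : ℝ) : ℂ) * I)‖ ^ 2 ≤
      (B - A) * ∑ n ∈ S, ‖a n‖ ^ 2 + 2 * (∑ n ∈ S, ‖a n‖) ^ 2 +
        4 * (1 + Real.log N) * ∑ n ∈ S, n * ‖a n‖ ^ 2 := by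
  set J : ℕ → ℕ → ℂ := fun m n => ∫ t in A..B, exp (((t * (Real.log m - Real.log n) : ℝ) : ℂ) * I)
    with hJ
  have hcont : ∀ l : ℝ, Continuous fun t : ℝ => exp (((t * l : ℝ) : ℂ) * I) := by
    intro l; fun_prop
  have hexp : ((∫ t in A..B, ‖∑ n ∈ S, a n * exp (((t * Real.log n : ℝ) : ℂ) * I)‖ ^ 2 : ℝ) : ℂ) =
      ∑ m ∈ S, ∑ n ∈ S, a m * (starRingEnd ℂ) (a n) * J m n := by
    rw [← intervalIntegral.integral_ofReal]
    have e : ∀ t : ℝ, ((‖∑ n ∈ S, a n * exp (((t * Real.log n : ℝ) : ℂ) * I)‖ ^ 2 : ℝ) : ℂ) =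
        ∑ m ∈ S, ∑ n ∈ S, a m * (starRingEnd ℂ) (a n) *
          exp (((t * (Real.log m - Real.log n) : ℝ) : ℂ) * I) := by
      intro t
      rw [ofReal_pow, ← mul_conj', map_sum, sum_mul_sum]
      refine sum_congr rfl fun m _ => sum_congr rfl fun n _ => ?_
      rw [map_mul, ← exp_conj, map_mul, conj_ofReal, conj_I]
      have : exp (((t * (Real.log m - Real.log n) : ℝ) : ℂ) * I) =
          exp (((t * Real.log m : ℝ) : ℂ) * I) * exp (((t * Real.log n : ℝ) : ℂ) * -I) := by
        rw [← exp_add]; congr 1; push_cast; ring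
      rw [this]
      ring
    simp_rw [e]
    rw [intervalIntegral.integral_finsetSum]
    · refine sum_congr rfl fun m _ => ?_
      rw [intervalIntegral.integral_finsetSum]
      · refine sum_congr rfl fun n _ => ?_
        rw [intervalIntegral.integral_const_mul]
      · intro n _
        exact ((hcont _).const_mul _).intervalIntegrable _ _
    · intro m _
      refine Continuous.intervalIntegrable ?_ _ _
      exact continuous_finsetSum _ fun n _ => (hcont _).const_mul _
  set k : ℕ → ℕ → ℝ := fun m n =>
    if m = n then B - A else 2 + 2 * (Real.sqrt m * Real.sqrt n / |(m : ℝ) - n|) with hk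
  have hJk : ∀ m ∈ S, ∀ n ∈ S, ‖J m n‖ ≤ k m n := by
    intro m hm n hn
    simp only [hJ, hk]
    split_ifs with h
    · subst h
      refine (intervalIntegral.norm_integral_le_of_norm_le_const (C := 1) fun t _ => ?_).trans ?_
      · rw [norm_exp_ofReal_mul_I]
      · rw [one_mul, abs_of_nonneg (by linarith)]
    · have hl : Real.log m - Real.log n ≠ 0 := by
        rw [sub_ne_zero]
        intro e
        have := Real.log_injOn_pos (show (0 : ℝ) < m by exact_mod_cast (hS m hm).1)
          (show (0 : ℝ) < n by exact_mod_cast (hS n hn).1) e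
        exact h (by exact_mod_cast this)
      refine (norm_integral_exp_mul_I_le hl A B).trans ?_
      have := one_div_abs_log_sub_log_le (hS m hm).1 (hS n hn).1 h
      rw [div_eq_mul_one_div]
      linarith
  set I₀ := ∫ t in A..B, ‖∑ n ∈ S, a n * exp (((t * Real.log n : ℝ) : ℂ) * I)‖ ^ 2 with hI
  have hle : I₀ ≤ ∑ m ∈ S, ∑ n ∈ S, ‖a m‖ * ‖a n‖ * k m n := by
    calc I₀ ≤ ‖(I₀ : ℂ)‖ := by rw [norm_real]; exact le_abs_self _
      _ ≤ _ := by
        rw [hexp]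
        refine (norm_sum_le _ _).trans (sum_le_sum fun m hm => ?_)
        refine (norm_sum_le _ _).trans (sum_le_sum fun n hn => ?_)
        rw [norm_mul, norm_mul, Complex.norm_conj]
        gcongr
        exact hJk m hm n hn
  refine hle.trans ?_
  have hterm : ∀ m ∈ S, ∀ n ∈ S, ‖a m‖ * ‖a n‖ * k m n ≤
      (if m = n then (B - A) * ‖a m‖ ^ 2 else 0) + 2 * (‖a m‖ * ‖a n‖) +
      ((if n ≠ m then (m * ‖a m‖ ^ 2) * (1 / |(m : ℝ) - n|) else 0) +
       (if m ≠ n then (n * ‖a n‖ ^ 2) * (1 / |(n : ℝ) - m|) else 0)) := by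
    intro m hm n hn
    simp only [hk]
    by_cases h : m = n
    · subst h
      simp only [if_true, ne_eq, not_true_eq_false, if_false]
      nlinarith [mul_nonneg (norm_nonneg (a m)) (norm_nonneg (a m))]
    · simp only [h, if_false, ne_eq, not_false_eq_true, if_true, Ne.symm h]
      rw [abs_sub_comm (n : ℝ) m, zero_add, mul_add, ← add_mul]
      have h1 : 2 * ((Real.sqrt m * ‖a m‖) * (Real.sqrt n * ‖a n‖)) ≤
          m * ‖a m‖ ^ 2 + n * ‖a n‖ ^ 2 := by
        have := two_mul_le_add_sq (Real.sqrt m * ‖a m‖) (Real.sqrt n * ‖a n‖)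
        rw [mul_pow, mul_pow, Real.sq_sqrt (Nat.cast_nonneg _),
          Real.sq_sqrt (Nat.cast_nonneg _)] at this
        linarith
      have h2 := mul_le_mul_of_nonneg_right h1 (by positivity : 0 ≤ 1 / |(m : ℝ) - n|)
      have h3 : ‖a m‖ * ‖a n‖ * (2 * (Real.sqrt m * Real.sqrt n / |(m : ℝ) - n|)) =
          2 * ((Real.sqrt m * ‖a m‖) * (Real.sqrt n * ‖a n‖)) * (1 / |(m : ℝ) - n|) := by ring
      linarith
  have hrow : ∀ m ∈ S, ∑ n ∈ S, (if n ≠ m then (m * ‖a m‖ ^ 2) * (1 / |(m : ℝ) - n|) else 0) ≤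
      (m * ‖a m‖ ^ 2) * (2 * (1 + Real.log N)) := by
    intro m hm
    rw [← sum_filter, ← mul_sum]
    exact mul_le_mul_of_nonneg_left (sum_one_div_abs_sub_le hS hm) (by positivity)
  calc ∑ m ∈ S, ∑ n ∈ S, ‖a m‖ * ‖a n‖ * k m n
      ≤ ∑ m ∈ S, ∑ n ∈ S, ((if m = n then (B - A) * ‖a m‖ ^ 2 else 0) + 2 * (‖a m‖ * ‖a n‖) +
      ((if n ≠ m then (m * ‖a m‖ ^ 2) * (1 / |(m : ℝ) - n|) else 0) +
       (if m ≠ n then (n * ‖a n‖ ^ 2) * (1 / |(n : ℝ) - m|) else 0))) :=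
        sum_le_sum fun m hm => sum_le_sum fun n hn => hterm m hm n hn
    _ = (B - A) * ∑ n ∈ S, ‖a n‖ ^ 2 + 2 * (∑ n ∈ S, ‖a n‖) ^ 2 +
        (∑ m ∈ S, ∑ n ∈ S, (if n ≠ m then (m * ‖a m‖ ^ 2) * (1 / |(m : ℝ) - n|) else 0) +
         ∑ n ∈ S, ∑ m ∈ S, (if m ≠ n then (n * ‖a n‖ ^ 2) * (1 / |(n : ℝ) - m|) else 0)) := by
        simp only [sum_add_distrib]
        congr 1
        · congr 1
          · rw [mul_sum]
            refine sum_congr rfl fun m hm => ?_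
            simp [hm]
          · rw [sq, sum_mul_sum, mul_sum]
            refine sum_congr rfl fun m hm => ?_
            rw [mul_sum]
        · congr 1
          rw [sum_comm]
    _ ≤ (B - A) * ∑ n ∈ S, ‖a n‖ ^ 2 + 2 * (∑ n ∈ S, ‖a n‖) ^ 2 +
        (∑ m ∈ S, (m * ‖a m‖ ^ 2) * (2 * (1 + Real.log N)) +
         ∑ n ∈ S, (n * ‖a n‖ ^ 2) * (2 * (1 + Real.log N))) := by
        gcongr with m hm n hn
        · exact hrow m hm
        · exact hrow n hn
    _ = _ := by rw [← sum_mul]; ring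

/-- Mean value theorem for Dirichlet polynomials on a vertical segment. -/
theorem integral_norm_sum_cpow_sq_le {N : ℕ} {S : Finset ℕ} (hS : ∀ n ∈ S, 1 ≤ n ∧ n ≤ N)
    (c : ℕ → ℂ) (σ : ℝ) {A B : ℝ} (hAB : A ≤ B) :
    ∫ t in A..B, ‖∑ n ∈ S, c n * (n : ℂ) ^ (-((σ : ℂ) + t * I))‖ ^ 2 ≤
      (B - A) * ∑ n ∈ S, (‖c n‖ * (n : ℝ) ^ (-σ)) ^ 2 +
        2 * (∑ n ∈ S, ‖c n‖ * (n : ℝ) ^ (-σ)) ^ 2 +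
        4 * (1 + Real.log N) * ∑ n ∈ S, n * (‖c n‖ * (n : ℝ) ^ (-σ)) ^ 2 := by
  have h := integral_norm_sum_exp_log_sq_le hS
    (fun n => (starRingEnd ℂ) (c n) * ((n : ℝ) ^ (-σ) : ℝ)) hAB
  have e1 : ∀ n : ℕ, ‖(starRingEnd ℂ) (c n) * (((n : ℝ) ^ (-σ) : ℝ) : ℂ)‖ =
      ‖c n‖ * (n : ℝ) ^ (-σ) := by
    intro n
    rw [norm_mul, Complex.norm_conj, norm_real, Real.norm_eq_abs, abs_of_nonneg (by positivity)]
  simp only [e1] at h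
  refine le_of_eq_of_le ?_ h
  congr 1
  funext t
  congr 1
  rw [← Complex.norm_conj, map_sum]
  congr 1
  refine sum_congr rfl fun n hn => ?_
  have hn0 : (n : ℂ) ≠ 0 := by
    have := (hS n hn).1
    exact_mod_cast (by omega : n ≠ 0)
  rw [map_mul, mul_assoc]
  congr 1
  rw [ofReal_cpow (Nat.cast_nonneg n), cpow_def_of_ne_zero hn0, ofReal_natCast,
    cpow_def_of_ne_zero hn0, ← exp_conj, ← exp_add]
  congr 1
  rw [map_mul, map_neg, map_add, map_mul, conj_I, conj_ofReal, conj_ofReal, ← natCast_log, conj_ofReal]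
  push_cast
  ring

theorem exists_one_add_abs_pow_mul_exp_neg_sq_le (m : ℕ) :
    ∃ C > 0, ∀ y : ℝ, (1 + |y|) ^ m * Real.exp (-y ^ 2) ≤ C := by
  refine ⟨m.factorial * Real.exp 2, by positivity, fun y => ?_⟩
  have h1 := Real.pow_div_factorial_le_exp (1 + |y|) (by positivity) m
  rw [div_le_iff₀ (by positivity)] at h1
  have h2 : Real.exp (1 + |y|) * Real.exp (-y ^ 2) ≤ Real.exp 2 := by
    rw [← Real.exp_add]
    refine Real.exp_le_exp.2 ?_
    nlinarith [sq_abs y, sq_nonneg (|y| - 1)]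
  calc (1 + |y|) ^ m * Real.exp (-y ^ 2)
      ≤ (Real.exp (1 + |y|) * m.factorial) * Real.exp (-y ^ 2) := by gcongr
    _ = m.factorial * (Real.exp (1 + |y|) * Real.exp (-y ^ 2)) := by ring
    _ ≤ _ := by gcongr

theorem intervalIntegral_mul_sq_le {u v : ℝ → ℝ} (hu : Continuous u) (hv : Continuous v)
    {A B : ℝ} (hAB : A ≤ B) :
    (∫ t in A..B, u t * v t) ^ 2 ≤ (∫ t in A..B, u t ^ 2) * ∫ t in A..B, v t ^ 2 := by
  have h := discrim_le_zero (a := ∫ t in A..B, u t ^ 2) (b := 2 * ∫ t in A..B, u t * v t)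
    (c := ∫ t in A..B, v t ^ 2) fun x => by
      have e : (∫ t in A..B, u t ^ 2) * (x * x) + 2 * (∫ t in A..B, u t * v t) * x +
          ∫ t in A..B, v t ^ 2 = ∫ t in A..B, (u t * x + v t) ^ 2 := by
        rw [← intervalIntegral.integral_mul_const, ← intervalIntegral.integral_const_mul,
          ← intervalIntegral.integral_mul_const, ← intervalIntegral.integral_add,
          ← intervalIntegral.integral_add]
        · congr 1; ext t; ring
        all_goals exact Continuous.intervalIntegrable (by fun_prop) _ _
      rw [e]
      exact intervalIntegral.integral_nonneg hAB fun t _ => sq_nonneg _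
  unfold discrim at h
  linarith

theorem differentiable_intervalIntegral_translate {f : ℂ → ℂ} (hf : Differentiable ℂ f)
    {g : ℝ → ℂ} (hg : Continuous g) (A B : ℝ) :
    Differentiable ℂ fun w => ∫ t in A..B, f (w + t * I) * g t := by
  intro w₀
  have hf' : Continuous (deriv f) := (hf.contDiff (n := 1)).continuous_deriv le_rfl
  have hK : IsCompact (Metric.closedBall w₀ 1 ×ˢ Set.uIcc A B) :=
    (isCompact_closedBall w₀ 1).prod isCompact_uIcc
  obtain ⟨M, hM⟩ := hK.exists_bound_of_continuousOn
    (f := fun p : ℂ × ℝ => deriv f (p.1 + p.2 * I) * g p.2) (by fun_prop)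
  refine (intervalIntegral.hasDerivAt_integral_of_dominated_loc_of_deriv_le
    (F := fun w t => f (w + t * I) * g t) (F' := fun w t => deriv f (w + t * I) * g t)
    (bound := fun _ => M) (Metric.closedBall_mem_nhds w₀ one_pos) ?_ ?_ ?_ ?_ ?_ ?_).2.differentiableAt
  · have := hf.continuous
    exact Filter.Eventually.of_forall fun w => Continuous.aestronglyMeasurable (by fun_prop)
  · have := hf.continuous
    exact Continuous.intervalIntegrable (by fun_prop) _ _
  · exact Continuous.aestronglyMeasurable (by fun_prop)
  · exact Filter.Eventually.of_forall fun t ht w hw =>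
      hM (w, t) ⟨hw, Set.uIoc_subset_uIcc ht⟩
  · exact intervalIntegrable_const
  · refine Filter.Eventually.of_forall fun t _ w _ => ?_
    have := (hf (w + t * I)).hasDerivAt.comp_add_const w (t * I)
    exact this.mul_const _

/-- Gabriel's convexity theorem for quadratic means over a finite window, with a Gaussian weight
in the translation parameter. -/
theorem integral_norm_sq_le_interp {f : ℂ → ℂ} (hf : Differentiable ℂ f) {a b : ℝ} (hab : a < b)
    {K : ℝ} {m : ℕ} (hpoly : ∀ s : ℂ, a ≤ s.re → s.re ≤ b → ‖f s‖ ≤ K * (1 + ‖s‖) ^ m)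
    {T₀ T₁ : ℝ} (hT : T₀ ≤ T₁) {A B : ℝ}
    (hA : ∀ y : ℝ, Real.exp (-(2 * y ^ 2)) *
      ∫ t in T₀..T₁, ‖f ((a : ℂ) + ((t + y : ℝ) : ℂ) * I)‖ ^ 2 ≤ A)
    (hB : ∀ y : ℝ, Real.exp (-(2 * y ^ 2)) *
      ∫ t in T₀..T₁, ‖f ((b : ℂ) + ((t + y : ℝ) : ℂ) * I)‖ ^ 2 ≤ B)
    {σ : ℝ} (hσ : a ≤ σ) (hσ' : σ ≤ b) :
    ∫ t in T₀..T₁, ‖f ((σ : ℂ) + (t : ℂ) * I)‖ ^ 2 ≤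
      Real.exp (2 * (b - a) ^ 2) * (A ^ (1 - (σ - a) / (b - a)) * B ^ ((σ - a) / (b - a))) := by
  have hfc := hf.continuous
  set N := ∫ t in T₀..T₁, ‖f ((σ : ℂ) + (t : ℂ) * I)‖ ^ 2 with hN
  have hN0 : 0 ≤ N := intervalIntegral.integral_nonneg hT fun t _ => by positivity
  set θ := (σ - a) / (b - a) with hθ
  set g : ℝ → ℂ := fun t => (starRingEnd ℂ) (f ((σ : ℂ) + (t : ℂ) * I)) with hg
  have hgc : Continuous g := by
    simp only [hg]
    exact continuous_conj.comp (by fun_prop)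
  set G : ℂ → ℂ := fun w => exp ((w - σ) ^ 2) * ∫ t in T₀..T₁, f (w + t * I) * g t with hG
  have hGd : Differentiable ℂ G := by
    have := differentiable_intervalIntegral_translate hf hgc T₀ T₁
    simp only [hG]
    fun_prop
  have hexp : ∀ w : ℂ, a ≤ w.re → w.re ≤ b →
      ‖exp ((w - σ) ^ 2)‖ ≤ Real.exp ((b - a) ^ 2) * Real.exp (-w.im ^ 2) := by
    intro w h1 h2
    rw [norm_exp, ← Real.exp_add]
    refine Real.exp_le_exp.2 ?_
    have : ((w - σ) ^ 2).re = (w.re - σ) ^ 2 - w.im ^ 2 := by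
      simp [sq]
    rw [this]
    nlinarith
  have hline : ∀ (c : ℝ) (D : ℝ), a ≤ c → c ≤ b →
      (∀ y : ℝ, Real.exp (-(2 * y ^ 2)) *
        ∫ t in T₀..T₁, ‖f ((c : ℂ) + ((t + y : ℝ) : ℂ) * I)‖ ^ 2 ≤ D) →
      ∀ w ∈ re ⁻¹' {c}, ‖G w‖ ≤ Real.exp ((b - a) ^ 2) * Real.sqrt N * Real.sqrt D := by
    intro c D h1 h2 hD w hw
    have hwc : w.re = c := hw
    have e : ∀ t : ℝ, w + t * I = (c : ℂ) + ((t + w.im : ℝ) : ℂ) * I := by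
      intro t
      apply Complex.ext <;> simp [hwc, add_comm]
    set Q := ∫ t in T₀..T₁, ‖f (w + t * I)‖ ^ 2 with hQ
    have hQ0 : 0 ≤ Q := intervalIntegral.integral_nonneg hT fun t _ => by positivity
    have hQD : Real.exp (-(2 * w.im ^ 2)) * Q ≤ D := by
      have := hD w.im
      simp only [hQ, e]
      exact this
    have hcs : ‖∫ t in T₀..T₁, f (w + t * I) * g t‖ ≤ Real.sqrt Q * Real.sqrt N := by
      refine (intervalIntegral.norm_integral_le_integral_norm hT).trans ?_
      have e2 : ∀ t : ℝ, ‖f (w + t * I) * g t‖ = ‖f (w + t * I)‖ * ‖f ((σ : ℂ) + (t : ℂ) * I)‖ := by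
        intro t
        rw [norm_mul, hg, Complex.norm_conj]
      simp_rw [e2]
      rw [← Real.sqrt_mul hQ0]
      refine Real.le_sqrt_of_sq_le ?_
      exact intervalIntegral_mul_sq_le (u := fun t : ℝ => ‖f (w + t * I)‖)
        (v := fun t : ℝ => ‖f ((σ : ℂ) + (t : ℂ) * I)‖) (by fun_prop) (by fun_prop) hT
    have hs : Real.exp (-w.im ^ 2) * Real.sqrt Q ≤ Real.sqrt D := by
      refine Real.le_sqrt_of_sq_le ?_
      rw [mul_pow, Real.sq_sqrt hQ0, ← Real.exp_nat_mul]
      convert hQD using 3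
      push_cast; ring
    calc ‖G w‖ = ‖exp ((w - σ) ^ 2)‖ * ‖∫ t in T₀..T₁, f (w + t * I) * g t‖ := norm_mul _ _
      _ ≤ (Real.exp ((b - a) ^ 2) * Real.exp (-w.im ^ 2)) * (Real.sqrt Q * Real.sqrt N) := by
          gcongr
          exact hexp w (hwc ▸ h1) (hwc ▸ h2)
      _ = Real.exp ((b - a) ^ 2) * Real.sqrt N * (Real.exp (-w.im ^ 2) * Real.sqrt Q) := by ring
      _ ≤ _ := by gcongr
  have hbdd : BddAbove ((norm ∘ G) '' HadamardThreeLines.verticalClosedStrip a b) := by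
    obtain ⟨C, hC0, hC⟩ := exists_one_add_abs_pow_mul_exp_neg_sq_le m
    obtain ⟨M, hM⟩ := (isCompact_uIcc (a := T₀) (b := T₁)).exists_bound_of_continuousOn
      hgc.continuousOn
    set R := |a| + |b| + |T₀| + |T₁| with hR
    have hR0 : 0 ≤ R := by positivity
    refine ⟨Real.exp ((b - a) ^ 2) * (|K| * (1 + R) ^ m * C * |M| * |T₁ - T₀|), ?_⟩
    rintro _ ⟨w, ⟨h1, h2⟩, rfl⟩
    have hI : ‖∫ t in T₀..T₁, f (w + t * I) * g t‖ ≤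
        (|K| * ((1 + R) * (1 + |w.im|)) ^ m * |M|) * |T₁ - T₀| := by
      refine intervalIntegral.norm_integral_le_of_norm_le_const fun t ht => ?_
      have ht' := Set.uIoc_subset_uIcc ht
      rw [norm_mul]
      refine mul_le_mul ?_ ((hM t ht').trans (le_abs_self _)) (norm_nonneg _) (by positivity)
      refine (hpoly _ (by simpa using h1) (by simpa using h2)).trans ?_
      refine mul_le_mul (le_abs_self _) ?_ (by positivity) (abs_nonneg _)
      refine pow_le_pow_left₀ (by positivity) ?_ _
      have hw : ‖w‖ ≤ |w.re| + |w.im| := norm_le_abs_re_add_abs_im w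
      have hre : |w.re| ≤ |a| + |b| := by
        rw [abs_le]
        constructor
        · linarith [neg_abs_le a, abs_nonneg b]
        · linarith [le_abs_self b, abs_nonneg a]
      have htt : |t| ≤ |T₀| + |T₁| := by
        rw [Set.uIcc_of_le hT] at ht'
        rw [abs_le]
        constructor
        · linarith [neg_abs_le T₀, abs_nonneg T₁, ht'.1]
        · linarith [le_abs_self T₁, abs_nonneg T₀, ht'.2]
      have hn : ‖w + t * I‖ ≤ ‖w‖ + |t| := by
        refine (norm_add_le _ _).trans ?_
        simp
      have := mul_nonneg hR0 (abs_nonneg w.im)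
      nlinarith
    calc ‖G w‖ = ‖exp ((w - σ) ^ 2)‖ * ‖∫ t in T₀..T₁, f (w + t * I) * g t‖ := norm_mul _ _
      _ ≤ (Real.exp ((b - a) ^ 2) * Real.exp (-w.im ^ 2)) *
          ((|K| * ((1 + R) * (1 + |w.im|)) ^ m * |M|) * |T₁ - T₀|) := by
          gcongr
          exact hexp w h1 h2
      _ = Real.exp ((b - a) ^ 2) * (|K| * (1 + R) ^ m *
          ((1 + |w.im|) ^ m * Real.exp (-w.im ^ 2)) * |M| * |T₁ - T₀|) := by
          rw [mul_pow]; ring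
      _ ≤ _ := by
          gcongr
          exact hC _
  have hGσ : G σ = N := by
    simp only [hG, hg, sub_self, ne_eq, OfNat.ofNat_ne_zero, not_false_eq_true, zero_pow,
      Complex.exp_zero, one_mul, mul_conj', hN]
    rw [← intervalIntegral.integral_ofReal]
    push_cast
    rfl
  have key := HadamardThreeLines.norm_le_interp_of_mem_verticalClosedStrip' hab
    (z := (σ : ℂ)) (f := G) ⟨by simpa using hσ, by simpa using hσ'⟩ hGd.diffContOnCl hbdd
    (hline a A le_rfl hab.le hA) (hline b B hab.le le_rfl hB)
  rw [hGσ, norm_real, Real.norm_of_nonneg hN0, ofReal_re, ← hθ] at key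
  have hA0 : 0 ≤ A := le_trans (mul_nonneg (by positivity)
    (intervalIntegral.integral_nonneg hT fun t _ => by positivity)) (hA 0)
  have hB0 : 0 ≤ B := le_trans (mul_nonneg (by positivity)
    (intervalIntegral.integral_nonneg hT fun t _ => by positivity)) (hB 0)
  rcases hN0.eq_or_lt with h0 | h0
  · rw [← h0]; positivity
  set E := Real.exp ((b - a) ^ 2) with hE
  have hE0 : 0 < E := Real.exp_pos _
  have hP0 : 0 < E * Real.sqrt N := by positivity
  rw [Real.mul_rpow hP0.le (Real.sqrt_nonneg _), Real.mul_rpow hP0.le (Real.sqrt_nonneg _)] at key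
  have key2 : N ≤ E * Real.sqrt N * (Real.sqrt A ^ (1 - θ) * Real.sqrt B ^ θ) := by
    refine key.trans_eq ?_
    have : (E * Real.sqrt N) ^ (1 - θ) * (E * Real.sqrt N) ^ θ = E * Real.sqrt N := by
      rw [← Real.rpow_add hP0, sub_add_cancel, Real.rpow_one]
    calc _ = ((E * Real.sqrt N) ^ (1 - θ) * (E * Real.sqrt N) ^ θ) *
          (Real.sqrt A ^ (1 - θ) * Real.sqrt B ^ θ) := by ring
      _ = _ := by rw [this]
  have key3 : Real.sqrt N ≤ E * (Real.sqrt A ^ (1 - θ) * Real.sqrt B ^ θ) := by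
    have hs : 0 < Real.sqrt N := Real.sqrt_pos.2 h0
    refine le_of_mul_le_mul_left ?_ hs
    rw [Real.mul_self_sqrt hN0]
    linarith
  have hsq : ∀ (X p : ℝ), 0 ≤ X → (Real.sqrt X ^ p) ^ 2 = X ^ p := by
    intro X p hX
    rw [← Real.rpow_natCast, ← Real.rpow_mul (Real.sqrt_nonneg _), mul_comm, Real.rpow_mul
      (Real.sqrt_nonneg _), Real.rpow_natCast, Real.sq_sqrt hX]
  calc N = Real.sqrt N ^ 2 := (Real.sq_sqrt hN0).symm
    _ ≤ (E * (Real.sqrt A ^ (1 - θ) * Real.sqrt B ^ θ)) ^ 2 := by gcongr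
    _ = E ^ 2 * (A ^ (1 - θ) * B ^ θ) := by
        rw [mul_pow, mul_pow, hsq _ _ hA0, hsq _ _ hB0]
    _ = _ := by rw [hE, ← Real.exp_nat_mul]; norm_num

theorem exists_add_one_le_mul_two_rpow {ε : ℝ} (hε : 0 < ε) :
    ∃ C ≥ 1, ∀ k : ℕ, (k + 1 : ℝ) ≤ C * (2 : ℝ) ^ (ε * k) := by
  have hl : 0 < ε * Real.log 2 := mul_pos hε (Real.log_pos one_lt_two)
  refine ⟨1 + 1 / (ε * Real.log 2), le_add_of_nonneg_right (by positivity), fun k => ?_⟩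
  have h1 : 1 + ε * Real.log 2 * k ≤ (2 : ℝ) ^ (ε * k) := by
    rw [Real.rpow_def_of_pos two_pos]
    have := Real.add_one_le_exp (Real.log 2 * (ε * k))
    linarith
  have hk : (0 : ℝ) ≤ k := Nat.cast_nonneg k
  calc (k + 1 : ℝ) ≤ (1 + 1 / (ε * Real.log 2)) * (1 + ε * Real.log 2 * k) := by
        have : (1 + 1 / (ε * Real.log 2)) * (1 + ε * Real.log 2 * k) =
          (k + 1) + ε * Real.log 2 * k + 1 / (ε * Real.log 2) := by field_simp; ring
        rw [this]
        have : 0 ≤ ε * Real.log 2 * k + 1 / (ε * Real.log 2) := by positivity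
        linarith
    _ ≤ _ := by gcongr

/-- The divisor bound. -/
theorem exists_card_divisors_le {ε : ℝ} (hε : 0 < ε) :
    ∃ C > 0, ∀ n : ℕ, n ≠ 0 → (#n.divisors : ℝ) ≤ C * (n : ℝ) ^ ε := by
  obtain ⟨C, hC1, hC⟩ := exists_add_one_le_mul_two_rpow hε
  have hC0 : 0 < C := by linarith
  set P : ℕ := ⌈(2 : ℝ) ^ (1 / ε)⌉₊ with hP
  refine ⟨C ^ P, by positivity, fun n hn => ?_⟩
  have hn' : (n : ℝ) ^ ε = ∏ p ∈ n.primeFactors, (p : ℝ) ^ (ε * n.factorization p) := by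
    conv_lhs => rw [← Nat.prod_factorization_pow_eq_self hn]
    rw [Finsupp.prod, Nat.support_factorization, Nat.cast_prod, ← Real.finsetProd_rpow _ _
      (fun _ _ => Nat.cast_nonneg _)]
    refine prod_congr rfl fun p _ => ?_
    rw [Nat.cast_pow, ← Real.rpow_natCast, ← Real.rpow_mul (Nat.cast_nonneg _), mul_comm]
  have hterm : ∀ p ∈ n.primeFactors, ((n.factorization p + 1 : ℕ) : ℝ) ≤
      (if p < P then C else 1) * (p : ℝ) ^ (ε * n.factorization p) := by
    intro p hp
    have hp2 : (2 : ℝ) ≤ p := by exact_mod_cast (Nat.prime_of_mem_primeFactors hp).two_le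
    set k := n.factorization p
    push_cast
    split_ifs with h
    · refine (hC k).trans ?_
      gcongr
    · have h1 : (2 : ℝ) ^ (1 / ε) ≤ p :=
        (Nat.le_ceil _).trans (by exact_mod_cast not_lt.1 h)
      have h2 : (2 : ℝ) ≤ (p : ℝ) ^ ε := by
        calc (2 : ℝ) = ((2 : ℝ) ^ (1 / ε)) ^ ε := by
              rw [← Real.rpow_mul two_pos.le, one_div_mul_cancel hε.ne', Real.rpow_one]
          _ ≤ _ := Real.rpow_le_rpow (by positivity) h1 hε.le
      rw [one_mul, Real.rpow_mul (by positivity), Real.rpow_natCast]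
      calc (k + 1 : ℝ) ≤ 2 ^ k := by exact_mod_cast Nat.lt_two_pow_self
        _ ≤ _ := pow_le_pow_left₀ two_pos.le h2 k
  rw [Nat.card_divisors hn, hn', Nat.cast_prod]
  calc ∏ p ∈ n.primeFactors, ((n.factorization p + 1 : ℕ) : ℝ)
      ≤ ∏ p ∈ n.primeFactors, ((if p < P then C else 1) * (p : ℝ) ^ (ε * n.factorization p)) :=
        prod_le_prod (fun _ _ => Nat.cast_nonneg _) hterm
    _ = (∏ p ∈ n.primeFactors, if p < P then C else 1) *
          ∏ p ∈ n.primeFactors, (p : ℝ) ^ (ε * n.factorization p) := prod_mul_distrib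
    _ ≤ _ := by
        gcongr
        rw [← prod_filter, prod_const]
        refine pow_le_pow_right₀ hC1 ?_
        calc #(n.primeFactors.filter (· < P)) ≤ #(range P) :=
              card_le_card fun p hp => mem_range.2 (mem_filter.1 hp).2
          _ = P := card_range P

theorem hasSum_card_divisors_mul_cpow {s : ℂ} (hs : 1 < s.re) :
    HasSum (fun n : ℕ => (#n.divisors : ℂ) * (n : ℂ) ^ (-s)) (riemannZeta s ^ 2) := by
  have h := ArithmeticFunction.LSeriesHasSum_mul
    (f := (ArithmeticFunction.zeta : ArithmeticFunction ℂ))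
    (g := (ArithmeticFunction.zeta : ArithmeticFunction ℂ))
    (by simpa using ArithmeticFunction.LSeriesHasSum_zeta hs)
    (by simpa using ArithmeticFunction.LSeriesHasSum_zeta hs)
  rw [← sq (riemannZeta s)] at h
  have e : LSeries.term (⇑((ArithmeticFunction.zeta : ArithmeticFunction ℂ) *
      (ArithmeticFunction.zeta : ArithmeticFunction ℂ))) s =
      fun n : ℕ => (#n.divisors : ℂ) * (n : ℂ) ^ (-s) := by
    ext n
    rcases eq_or_ne n 0 with rfl | hn
    · simp
    · rw [LSeries.term_of_ne_zero hn, ArithmeticFunction.coe_zeta_mul_apply, cpow_neg, div_eq_mul_inv]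
      congr 1
      rw [card_eq_sum_ones, Nat.cast_sum]
      refine sum_congr rfl fun d hd => ?_
      simp [(Nat.pos_of_mem_divisors hd).ne']
  exact e ▸ h

theorem sum_rpow_le {ε : ℝ} (hε : 0 < ε) {S : Finset ℕ} (hS : ∀ n ∈ S, 1 ≤ n) {T p : ℝ}
    (hT : 0 ≤ T) (h : ∀ n ∈ S, (n : ℝ) ^ (p + 1 + ε) ≤ T ^ (p + 1 + ε)) :
    ∑ n ∈ S, (n : ℝ) ^ p ≤ (∑' n : ℕ, (n : ℝ) ^ (-1 - ε)) * T ^ (p + 1 + ε) := by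
  have hs : Summable fun n : ℕ => (n : ℝ) ^ (-1 - ε) := Real.summable_nat_rpow.2 (by linarith)
  calc ∑ n ∈ S, (n : ℝ) ^ p = ∑ n ∈ S, (n : ℝ) ^ (-1 - ε) * (n : ℝ) ^ (p + 1 + ε) := by
        refine sum_congr rfl fun n hn => ?_
        have : (0 : ℝ) < n := by exact_mod_cast hS n hn
        rw [← Real.rpow_add this]
        congr 1; ring
    _ ≤ ∑ n ∈ S, (n : ℝ) ^ (-1 - ε) * T ^ (p + 1 + ε) :=
        sum_le_sum fun n hn => mul_le_mul_of_nonneg_left (h n hn) (by positivity)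
    _ = (∑ n ∈ S, (n : ℝ) ^ (-1 - ε)) * T ^ (p + 1 + ε) := (sum_mul _ _ _).symm
    _ ≤ _ := by
        gcongr
        exact hs.sum_le_tsum _ fun _ _ => by positivity

theorem exists_sum_card_divisors_sq_le {ε : ℝ} (hε : 0 < ε) :
    ∃ C > 0, ∀ (S : Finset ℕ) (σ T : ℝ), 0 ≤ T → (∀ n ∈ S, 1 ≤ n) →
      (∀ n ∈ S, (n : ℝ) ^ (2 * ε - 2 * σ + 1 + ε) ≤ T ^ (2 * ε - 2 * σ + 1 + ε)) →
      ∑ n ∈ S, ((#n.divisors : ℝ) * (n : ℝ) ^ (-σ)) ^ 2 ≤ C * T ^ (2 * ε - 2 * σ + 1 + ε) := by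
  obtain ⟨C, hC, h⟩ := exists_card_divisors_le hε
  set Z := ∑' n : ℕ, (n : ℝ) ^ (-1 - ε) with hZ
  have hZ0 : 0 ≤ Z := tsum_nonneg fun _ => by positivity
  refine ⟨C ^ 2 * (Z + 1), by positivity, fun S σ T hT hS hn => ?_⟩
  calc ∑ n ∈ S, ((#n.divisors : ℝ) * (n : ℝ) ^ (-σ)) ^ 2
      ≤ ∑ n ∈ S, C ^ 2 * (n : ℝ) ^ (2 * ε - 2 * σ) := by
        refine sum_le_sum fun n hm => ?_
        have h0 : (0 : ℝ) < n := by exact_mod_cast hS n hm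
        have e : (n : ℝ) ^ (2 * ε - 2 * σ) = ((n : ℝ) ^ ε * (n : ℝ) ^ (-σ)) ^ 2 := by
          rw [← Real.rpow_add h0, ← Real.rpow_natCast, ← Real.rpow_mul h0.le]
          congr 1; push_cast; ring
        rw [e, ← mul_pow, ← mul_assoc]
        gcongr
        exact h n (by have := hS n hm; omega)
    _ = C ^ 2 * ∑ n ∈ S, (n : ℝ) ^ (2 * ε - 2 * σ) := (mul_sum _ _ _).symm
    _ ≤ C ^ 2 * (Z * T ^ (2 * ε - 2 * σ + 1 + ε)) := by
        gcongr
        exact sum_rpow_le hε hS hT hn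
    _ ≤ _ := by
        rw [← mul_assoc]
        gcongr
        linarith

theorem exists_integral_norm_sum_card_divisors_sq_le {ε : ℝ} (hε : 0 < ε) :
    ∃ C > 0, ∀ (S : Finset ℕ) (N : ℕ) (σ T : ℝ), 1 ≤ T → (∀ n ∈ S, 1 ≤ n ∧ n ≤ N) →
      Real.log N ≤ 3 * Real.log T →
      (∀ n ∈ S, (n : ℝ) ^ (ε - σ + 1 + ε) ≤ T ^ (ε - σ + 1 + ε)) →
      (∀ n ∈ S, (n : ℝ) ^ (2 * ε + 1 - 2 * σ + 1 + ε) ≤ T ^ (2 * ε + 1 - 2 * σ + 1 + ε)) →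
      ∀ A B : ℝ, A ≤ B →
      ∫ t in A..B, ‖∑ n ∈ S, (#n.divisors : ℂ) * (n : ℂ) ^ (-((σ : ℂ) + t * I))‖ ^ 2 ≤
        (B - A) * ∑ n ∈ S, ((#n.divisors : ℝ) * (n : ℝ) ^ (-σ)) ^ 2 +
          C * T ^ (2 - 2 * σ + 4 * ε) := by
  obtain ⟨C, hC, h⟩ := exists_card_divisors_le hε
  set Z := ∑' n : ℕ, (n : ℝ) ^ (-1 - ε) with hZ
  have hZ0 : 0 ≤ Z := tsum_nonneg fun _ => by positivity
  refine ⟨2 * (C * Z) ^ 2 + 4 * (1 + 3 / ε) * (C ^ 2 * Z) + 1, by positivity,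
    fun S N σ T hT hS hN hc1 hc2 A B hAB => ?_⟩
  have hT0 : 0 < T := by linarith
  refine (integral_norm_sum_cpow_sq_le hS (fun n => (#n.divisors : ℂ)) σ hAB).trans ?_
  simp only [norm_natCast]
  have h1 : ∑ n ∈ S, (#n.divisors : ℝ) * (n : ℝ) ^ (-σ) ≤ C * Z * T ^ (ε - σ + 1 + ε) := by
    calc ∑ n ∈ S, (#n.divisors : ℝ) * (n : ℝ) ^ (-σ)
        ≤ ∑ n ∈ S, C * (n : ℝ) ^ (ε - σ) := by
          refine sum_le_sum fun n hm => ?_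
          have h0 : (0 : ℝ) < n := by exact_mod_cast (hS n hm).1
          rw [sub_eq_add_neg, Real.rpow_add h0, ← mul_assoc]
          gcongr
          exact h n (by have := hS n hm; omega)
      _ = C * ∑ n ∈ S, (n : ℝ) ^ (ε - σ) := (mul_sum _ _ _).symm
      _ ≤ C * (Z * T ^ (ε - σ + 1 + ε)) := by
          gcongr
          exact sum_rpow_le hε (fun n hn => (hS n hn).1) hT0.le hc1
      _ = _ := by ring
  have h2 : ∑ n ∈ S, (n : ℝ) * ((#n.divisors : ℝ) * (n : ℝ) ^ (-σ)) ^ 2 ≤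
      C ^ 2 * Z * T ^ (2 * ε + 1 - 2 * σ + 1 + ε) := by
    calc ∑ n ∈ S, (n : ℝ) * ((#n.divisors : ℝ) * (n : ℝ) ^ (-σ)) ^ 2
        ≤ ∑ n ∈ S, C ^ 2 * (n : ℝ) ^ (2 * ε + 1 - 2 * σ) := by
          refine sum_le_sum fun n hm => ?_
          have h0 : (0 : ℝ) < n := by exact_mod_cast (hS n hm).1
          have e : (n : ℝ) ^ (2 * ε + 1 - 2 * σ) = n * ((n : ℝ) ^ ε * (n : ℝ) ^ (-σ)) ^ 2 := by
            rw [← Real.rpow_add h0, ← Real.rpow_natCast, ← Real.rpow_mul h0.le,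
              mul_comm (n : ℝ), ← Real.rpow_add_one h0.ne']
            congr 1; push_cast; ring
          rw [e, mul_left_comm, ← mul_pow, ← mul_assoc C]
          gcongr
          exact h n (by have := hS n hm; omega)
      _ = C ^ 2 * ∑ n ∈ S, (n : ℝ) ^ (2 * ε + 1 - 2 * σ) := (mul_sum _ _ _).symm
      _ ≤ C ^ 2 * (Z * T ^ (2 * ε + 1 - 2 * σ + 1 + ε)) := by
          gcongr
          exact sum_rpow_le hε (fun n hn => (hS n hn).1) hT0.le hc2
      _ = _ := by ring
  have h3 : 1 + Real.log N ≤ (1 + 3 / ε) * T ^ ε := by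
    have h4 := Real.log_le_rpow_div hT0.le hε
    have h5 : 1 ≤ T ^ ε := Real.one_le_rpow hT hε.le
    calc 1 + Real.log N ≤ T ^ ε + 3 * (T ^ ε / ε) := by linarith
      _ = _ := by ring
  have hlogN : 0 ≤ Real.log N := Real.log_natCast_nonneg N
  have e1 : (T ^ (ε - σ + 1 + ε)) ^ 2 = T ^ (2 - 2 * σ + 4 * ε) := by
    rw [← Real.rpow_natCast, ← Real.rpow_mul hT0.le]
    congr 1; push_cast; ring
  have e2 : T ^ ε * T ^ (2 * ε + 1 - 2 * σ + 1 + ε) = T ^ (2 - 2 * σ + 4 * ε) := by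
    rw [← Real.rpow_add hT0]
    congr 1; ring
  have h5 : 2 * (∑ n ∈ S, (#n.divisors : ℝ) * (n : ℝ) ^ (-σ)) ^ 2 ≤
      2 * (C * Z) ^ 2 * T ^ (2 - 2 * σ + 4 * ε) := by
    rw [← e1, mul_assoc, ← mul_pow]
    exact mul_le_mul_of_nonneg_left
      (pow_le_pow_left₀ (sum_nonneg fun _ _ => by positivity) h1 2) two_pos.le
  have h6 : 4 * (1 + Real.log N) *
      ∑ n ∈ S, (n : ℝ) * ((#n.divisors : ℝ) * (n : ℝ) ^ (-σ)) ^ 2 ≤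
      4 * (1 + 3 / ε) * (C ^ 2 * Z) * T ^ (2 - 2 * σ + 4 * ε) := by
    calc _ ≤ 4 * ((1 + 3 / ε) * T ^ ε) * (C ^ 2 * Z * T ^ (2 * ε + 1 - 2 * σ + 1 + ε)) :=
          mul_le_mul (mul_le_mul_of_nonneg_left h3 (by norm_num)) h2
            (sum_nonneg fun _ _ => by positivity) (by positivity)
      _ = _ := by rw [← e2]; ring
  have h7 : 0 ≤ T ^ (2 - 2 * σ + 4 * ε) := by positivity
  linarith

/-- Truncation at `T` of the Dirichlet series of the squared zeta function. -/
noncomputable def divisorSum (T : ℝ) (s : ℂ) : ℂ :=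
  ∑ n ∈ Icc 1 ⌊T⌋₊, (#n.divisors : ℂ) * (n : ℂ) ^ (-s)

theorem log_floor_pow_le {T : ℝ} (hT : 1 ≤ T) (k : ℕ) :
    Real.log (⌊T ^ k⌋₊ : ℝ) ≤ k * Real.log T := by
  have h1 : 1 ≤ T ^ k := one_le_pow₀ hT
  rw [← Real.log_pow]
  refine Real.log_le_log ?_ (Nat.floor_le (by positivity))
  exact_mod_cast Nat.floor_pos.2 h1

theorem exists_integral_divisorSum_left_sq_le {δ : ℝ} (hδ : 0 < δ) (hδ' : δ ≤ 1 / 8) :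
    ∃ C > 0, ∀ T A B : ℝ, 1 ≤ T → A ≤ B → B - A ≤ T →
      ∫ t in A..B, ‖divisorSum T (((1 / 2 - δ : ℝ) : ℂ) + t * I)‖ ^ 2 ≤ C * T ^ (1 + 3 * δ) := by
  obtain ⟨C, hC, h⟩ := exists_integral_norm_sum_card_divisors_sq_le (ε := δ / 4) (by linarith)
  obtain ⟨C', hC', h'⟩ := exists_sum_card_divisors_sq_le (ε := δ / 4) (by linarith)
  refine ⟨C' + C, by positivity, fun T A B hT hAB hL => ?_⟩
  have hT0 : 0 < T := by linarith
  have hS : ∀ n ∈ Icc 1 ⌊T⌋₊, 1 ≤ n ∧ n ≤ ⌊T⌋₊ := fun n hn => mem_Icc.1 hn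
  have hle : ∀ p : ℝ, 0 ≤ p → ∀ n ∈ Icc 1 ⌊T⌋₊, (n : ℝ) ^ p ≤ T ^ p := fun p hp n hn =>
    Real.rpow_le_rpow (Nat.cast_nonneg _) ((Nat.le_floor_iff hT0.le).1 (hS n hn).2) hp
  have hlog : Real.log ⌊T⌋₊ ≤ 3 * Real.log T := by
    have := log_floor_pow_le hT 1
    have := Real.log_nonneg hT
    simp only [pow_one, Nat.cast_one, one_mul] at *
    linarith
  have h1 := h (Icc 1 ⌊T⌋₊) ⌊T⌋₊ (1 / 2 - δ) T hT hS hlog (hle _ (by linarith))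
    (hle _ (by linarith)) A B hAB
  have h2 := h' (Icc 1 ⌊T⌋₊) (1 / 2 - δ) T hT0.le (fun n hn => (hS n hn).1) (hle _ (by linarith))
  have h3 : T * T ^ (2 * (δ / 4) - 2 * (1 / 2 - δ) + 1 + δ / 4) ≤ T ^ (1 + 3 * δ) := by
    rw [mul_comm, ← Real.rpow_add_one hT0.ne']
    exact Real.rpow_le_rpow_of_exponent_le hT (by linarith)
  have e : 2 - 2 * (1 / 2 - δ) + 4 * (δ / 4) = 1 + 3 * δ := by ring
  rw [e] at h1
  unfold divisorSum
  refine h1.trans ?_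
  rw [add_mul]
  refine add_le_add_left ?_ _
  calc _ ≤ T * (C' * T ^ (2 * (δ / 4) - 2 * (1 / 2 - δ) + 1 + δ / 4)) :=
        mul_le_mul hL h2 (sum_nonneg fun _ _ => by positivity) hT0.le
    _ = C' * (T * T ^ (2 * (δ / 4) - 2 * (1 / 2 - δ) + 1 + δ / 4)) := by ring
    _ ≤ _ := by gcongr

theorem exists_integral_divisorSum_sq_le {δ : ℝ} (hδ : 0 < δ) (hδ' : δ ≤ 1 / 8) :
    ∃ C > 0, ∀ T A B : ℝ, 1 ≤ T → A ≤ B → B - A ≤ T →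
      ∫ t in A..B, ‖divisorSum T (((1 / 2 + δ : ℝ) : ℂ) + t * I)‖ ^ 2 ≤ C * T := by
  obtain ⟨C, hC, h⟩ := exists_integral_norm_sum_card_divisors_sq_le (ε := δ / 4) (by linarith)
  obtain ⟨C', hC', h'⟩ := exists_sum_card_divisors_sq_le (ε := δ / 4) (by linarith)
  refine ⟨C' + C, by positivity, fun T A B hT hAB hL => ?_⟩
  have hT0 : 0 < T := by linarith
  have hS : ∀ n ∈ Icc 1 ⌊T⌋₊, 1 ≤ n ∧ n ≤ ⌊T⌋₊ := fun n hn => mem_Icc.1 hn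
  have hle : ∀ p : ℝ, 0 ≤ p → ∀ n ∈ Icc 1 ⌊T⌋₊, (n : ℝ) ^ p ≤ T ^ p := fun p hp n hn =>
    Real.rpow_le_rpow (Nat.cast_nonneg _) ((Nat.le_floor_iff hT0.le).1 (hS n hn).2) hp
  have hlog : Real.log ⌊T⌋₊ ≤ 3 * Real.log T := by
    have := log_floor_pow_le hT 1
    have := Real.log_nonneg hT
    simp only [pow_one, Nat.cast_one, one_mul] at *
    linarith
  have h1 := h (Icc 1 ⌊T⌋₊) ⌊T⌋₊ (1 / 2 + δ) T hT hS hlog (hle _ (by linarith))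
    (hle _ (by linarith)) A B hAB
  have h2 := h' (Icc 1 ⌊T⌋₊) (1 / 2 + δ) 1 one_pos.le (fun n hn => (hS n hn).1) fun n hn => by
    rw [Real.one_rpow]
    exact Real.rpow_le_one_of_one_le_of_nonpos (by exact_mod_cast (hS n hn).1) (by linarith)
  rw [Real.one_rpow, mul_one] at h2
  have h3 : T ^ (2 - 2 * (1 / 2 + δ) + 4 * (δ / 4)) ≤ T := by
    conv_rhs => rw [← Real.rpow_one T]
    exact Real.rpow_le_rpow_of_exponent_le hT (by linarith)
  unfold divisorSum
  refine h1.trans ?_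
  rw [add_mul]
  refine add_le_add ?_ (by gcongr)
  calc _ ≤ T * C' := mul_le_mul hL h2 (sum_nonneg fun _ _ => by positivity) hT0.le
    _ = _ := by ring

theorem exists_norm_riemannZeta_sq_sub_sum_le :
    ∃ C > 0, ∀ (T t : ℝ), 1 ≤ T →
      ‖riemannZeta ((4 : ℝ) + t * I) ^ 2 -
        ∑ n ∈ Icc 1 ⌊T ^ 3⌋₊, (#n.divisors : ℂ) * (n : ℂ) ^ (-(((4 : ℝ) : ℂ) + t * I))‖ ≤
      C * T ^ (-(9 / 2) : ℝ) := by
  have hs : Summable fun n : ℕ => (n : ℝ) ^ (-(3 / 2) : ℝ) :=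
    Real.summable_nat_rpow.2 (by norm_num)
  set Z := ∑' n : ℕ, (n : ℝ) ^ (-(3 / 2) : ℝ) with hZ
  have hZ0 : 0 ≤ Z := tsum_nonneg fun _ => by positivity
  refine ⟨Z + 1, by positivity, fun T t hT => ?_⟩
  have hT0 : 0 < T := by linarith
  have h := hasSum_card_divisors_mul_cpow (s := ((4 : ℝ) : ℂ) + t * I) (by simp)
  set S := Icc 1 ⌊T ^ 3⌋₊ with hS
  set F : ℕ → ℂ := fun n => (#n.divisors : ℂ) * (n : ℂ) ^ (-(((4 : ℝ) : ℂ) + t * I)) with hF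
  have h1 : HasSum (fun n => if n ∈ S then 0 else F n)
      (riemannZeta ((4 : ℝ) + t * I) ^ 2 - ∑ n ∈ S, F n) := by
    have h2 : HasSum (fun n => if n ∈ S then F n else 0) (∑ n ∈ S, F n) := by
      rw [← sum_congr rfl fun n hn => if_pos (t := F n) (e := 0) hn]
      exact hasSum_sum_of_ne_finset_zero fun n hn => if_neg hn
    have h3 := h.sub h2
    have e : (fun n => if n ∈ S then 0 else F n) = fun n => F n - if n ∈ S then F n else 0 := by
      ext n
      split_ifs <;> simp
    rw [e]
    exact h3
  have h4 : ∀ n : ℕ, ‖if n ∈ S then 0 else F n‖ ≤ (n : ℝ) ^ (-(3 / 2) : ℝ) * T ^ (-(9 / 2) : ℝ) := by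
    intro n
    split_ifs with hn
    · rw [norm_zero]; positivity
    rcases Nat.eq_zero_or_pos n with rfl | hn0
    · simp only [hF, Nat.divisors_zero, card_empty, Nat.cast_zero, zero_mul, norm_zero]
      positivity
    have hn1 : (0 : ℝ) < n := by exact_mod_cast hn0
    have hn2 : T ^ 3 < n := by
      by_contra hcon
      exact hn (mem_Icc.2 ⟨hn0, Nat.le_floor (not_lt.1 hcon)⟩)
    have hn3 : (n : ℝ) ^ (-(3 / 2) : ℝ) ≤ T ^ (-(9 / 2) : ℝ) := by
      refine (Real.rpow_le_rpow_of_nonpos (by positivity) hn2.le (by norm_num)).trans_eq ?_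
      rw [← Real.rpow_natCast, ← Real.rpow_mul hT0.le]
      norm_num
    have hn4 : ‖F n‖ ≤ n * (n : ℝ) ^ (-4 : ℝ) := by
      simp only [hF]
      rw [norm_mul, Complex.norm_natCast, norm_natCast_cpow_of_pos hn0]
      have e : (-(((4 : ℝ) : ℂ) + t * I)).re = -4 := by simp
      rw [e]
      gcongr
      exact Nat.card_divisors_le_self n
    calc ‖F n‖ ≤ n * (n : ℝ) ^ (-4 : ℝ) := hn4
      _ = (n : ℝ) ^ (-(3 / 2) : ℝ) * (n : ℝ) ^ (-(3 / 2) : ℝ) := by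
          rw [mul_comm, ← Real.rpow_add_one hn1.ne', ← Real.rpow_add hn1]
          norm_num
      _ ≤ _ := by gcongr
  refine (h1.norm_le_of_bounded (hs.hasSum.mul_right (T ^ (-(9 / 2) : ℝ))) h4).trans ?_
  gcongr
  linarith

theorem exists_integral_riemannZeta_sq_sub_divisorSum_sq_le {δ : ℝ} (hδ : 0 < δ)
    (hδ' : δ ≤ 1 / 8) :
    ∃ C > 0, ∀ T A B : ℝ, 1 ≤ T → A ≤ B → B - A ≤ T →
      ∫ t in A..B, ‖riemannZeta ((4 : ℝ) + t * I) ^ 2 - divisorSum T (((4 : ℝ) : ℂ) + t * I)‖ ^ 2 ≤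
        C * T ^ (-6 + δ) := by
  obtain ⟨C, hC, h⟩ := exists_integral_norm_sum_card_divisors_sq_le (ε := δ / 4) (by linarith)
  obtain ⟨C', hC', h'⟩ := exists_sum_card_divisors_sq_le (ε := δ / 4) (by linarith)
  obtain ⟨D, hD, h''⟩ := exists_norm_riemannZeta_sq_sub_sum_le
  refine ⟨2 * D ^ 2 + 2 * (C' + C), by positivity, fun T A B hT hAB hL => ?_⟩
  have hT0 : 0 < T := by linarith
  set S := Ioc ⌊T⌋₊ ⌊T ^ 3⌋₊ with hSdef
  have hS : ∀ n ∈ S, 1 ≤ n ∧ n ≤ ⌊T ^ 3⌋₊ := fun n hn => by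
    have := mem_Ioc.1 hn
    omega
  have hle : ∀ p : ℝ, p ≤ 0 → ∀ n ∈ S, (n : ℝ) ^ p ≤ T ^ p := fun p hp n hn =>
    Real.rpow_le_rpow_of_nonpos hT0 (Nat.lt_of_floor_lt (mem_Ioc.1 hn).1).le hp
  have hlog : Real.log ⌊T ^ 3⌋₊ ≤ 3 * Real.log T := log_floor_pow_le hT 3
  have h1 := h S ⌊T ^ 3⌋₊ 4 T hT hS hlog (hle _ (by linarith)) (hle _ (by linarith)) A B hAB
  have h2 := h' S 4 T hT0.le (fun n hn => (hS n hn).1) (hle _ (by linarith))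
  have h3 : T * T ^ (2 * (δ / 4) - 2 * 4 + 1 + δ / 4) ≤ T ^ (-6 + δ) := by
    rw [mul_comm, ← Real.rpow_add_one hT0.ne']
    exact Real.rpow_le_rpow_of_exponent_le hT (by linarith)
  have e : 2 - 2 * (4 : ℝ) + 4 * (δ / 4) = -6 + δ := by ring
  rw [e] at h1
  set V : ℝ → ℂ := fun t => ∑ n ∈ S, (#n.divisors : ℂ) * (n : ℂ) ^ (-(((4 : ℝ) : ℂ) + t * I))
    with hV
  have hVc : Continuous V := by
    refine continuous_finsetSum _ fun n hn => continuous_const.mul ?_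
    have : (n : ℂ) ≠ 0 := by
      have := (hS n hn).1
      exact_mod_cast (by omega : n ≠ 0)
    exact Continuous.const_cpow (by fun_prop) (Or.inl this)
  have hpt : ∀ t : ℝ,
      ‖riemannZeta ((4 : ℝ) + t * I) ^ 2 - divisorSum T (((4 : ℝ) : ℂ) + t * I)‖ ^ 2 ≤
      2 * (D * T ^ (-(9 / 2) : ℝ)) ^ 2 + 2 * ‖V t‖ ^ 2 := by
    intro t
    have hsplit : ∑ n ∈ Icc 1 ⌊T ^ 3⌋₊, (#n.divisors : ℂ) * (n : ℂ) ^ (-(((4 : ℝ) : ℂ) + t * I)) =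
        divisorSum T (((4 : ℝ) : ℂ) + t * I) + V t := by
      have hTT : ⌊T⌋₊ ≤ ⌊T ^ 3⌋₊ := Nat.floor_mono (le_self_pow₀ hT (by norm_num))
      have hu : Icc 1 ⌊T ^ 3⌋₊ = Icc 1 ⌊T⌋₊ ∪ S := by
        ext n
        simp only [hSdef, mem_union, mem_Icc, mem_Ioc]
        omega
      rw [hu, sum_union, divisorSum]
      rw [disjoint_left]
      intro n hn hn'
      have := (mem_Icc.1 hn).2
      have := (mem_Ioc.1 hn').1
      omega
    have h5 := h'' T t hT
    rw [hsplit] at h5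
    have h6 : ‖riemannZeta ((4 : ℝ) + t * I) ^ 2 - divisorSum T (((4 : ℝ) : ℂ) + t * I)‖ ≤
        D * T ^ (-(9 / 2) : ℝ) + ‖V t‖ := by
      calc _ = ‖(riemannZeta ((4 : ℝ) + t * I) ^ 2 -
            (divisorSum T (((4 : ℝ) : ℂ) + t * I) + V t)) + V t‖ := by congr 1; ring
        _ ≤ _ := (norm_add_le _ _).trans (by gcongr)
    calc _ ≤ (D * T ^ (-(9 / 2) : ℝ) + ‖V t‖) ^ 2 := by gcongr
      _ ≤ _ := by nlinarith [sq_nonneg (D * T ^ (-(9 / 2) : ℝ) - ‖V t‖)]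
  have hgi : IntervalIntegrable (fun t => 2 * (D * T ^ (-(9 / 2) : ℝ)) ^ 2 + 2 * ‖V t‖ ^ 2)
      MeasureTheory.volume A B := Continuous.intervalIntegrable (by fun_prop) _ _
  have h7 : ∫ t in A..B,
      ‖riemannZeta ((4 : ℝ) + t * I) ^ 2 - divisorSum T (((4 : ℝ) : ℂ) + t * I)‖ ^ 2 ≤
      ∫ t in A..B, (2 * (D * T ^ (-(9 / 2) : ℝ)) ^ 2 + 2 * ‖V t‖ ^ 2) := by
    rw [intervalIntegral.integral_of_le hAB, intervalIntegral.integral_of_le hAB]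
    refine MeasureTheory.integral_mono_of_nonneg (Filter.Eventually.of_forall fun t => sq_nonneg _)
      ((intervalIntegrable_iff_integrableOn_Ioc_of_le hAB).1 hgi)
      (Filter.Eventually.of_forall hpt)
  refine h7.trans ?_
  rw [intervalIntegral.integral_add (by simp)
    (Continuous.intervalIntegrable (by fun_prop) _ _), intervalIntegral.integral_const,
    intervalIntegral.integral_const_mul, smul_eq_mul, add_mul]
  refine add_le_add ?_ ?_
  · have e9 : T * (T ^ (-(9 / 2) : ℝ)) ^ 2 ≤ T ^ (-6 + δ) := by
      rw [← Real.rpow_natCast, ← Real.rpow_mul hT0.le, mul_comm, ← Real.rpow_add_one hT0.ne']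
      exact Real.rpow_le_rpow_of_exponent_le hT (by push_cast; linarith)
    calc (B - A) * (2 * (D * T ^ (-(9 / 2) : ℝ)) ^ 2) ≤ T * (2 * (D * T ^ (-(9 / 2) : ℝ)) ^ 2) := by
          gcongr
      _ = 2 * D ^ 2 * (T * (T ^ (-(9 / 2) : ℝ)) ^ 2) := by ring
      _ ≤ _ := by gcongr
  · rw [mul_assoc]
    refine mul_le_mul_of_nonneg_left (h1.trans ?_) two_pos.le
    rw [add_mul]
    refine add_le_add_left ?_ _
    calc _ ≤ T * (C' * T ^ (2 * (δ / 4) - 2 * 4 + 1 + δ / 4)) :=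
          mul_le_mul hL h2 (sum_nonneg fun _ _ => by positivity) hT0.le
      _ = C' * (T * T ^ (2 * (δ / 4) - 2 * 4 + 1 + δ / 4)) := by ring
      _ ≤ _ := by gcongr

theorem exists_integral_norm_sq_le_interp {a b : ℝ} (hab : a < b) (k : ℕ) :
    ∃ C > 0, ∀ (f : ℂ → ℂ), Differentiable ℂ f → ∀ (K : ℝ) (m : ℕ),
      (∀ s : ℂ, a ≤ s.re → s.re ≤ b → ‖f s‖ ≤ K * (1 + ‖s‖) ^ m) →
      ∀ T₀ T₁ A B : ℝ, T₀ ≤ T₁ → 0 ≤ A → 0 ≤ B →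
      (∀ y : ℝ, ∫ t in T₀..T₁, ‖f ((a : ℂ) + ((t + y : ℝ) : ℂ) * I)‖ ^ 2 ≤ A * (1 + |y|) ^ k) →
      (∀ y : ℝ, ∫ t in T₀..T₁, ‖f ((b : ℂ) + ((t + y : ℝ) : ℂ) * I)‖ ^ 2 ≤ B * (1 + |y|) ^ k) →
      ∀ σ : ℝ, a ≤ σ → σ ≤ b →
      ∫ t in T₀..T₁, ‖f ((σ : ℂ) + (t : ℂ) * I)‖ ^ 2 ≤
        C * (A ^ (1 - (σ - a) / (b - a)) * B ^ ((σ - a) / (b - a))) := by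
  obtain ⟨C, hC, h⟩ := exists_one_add_abs_pow_mul_exp_neg_sq_le k
  refine ⟨Real.exp (2 * (b - a) ^ 2) * C, by positivity,
    fun f hf K m hpoly T₀ T₁ A B hT hA0 hB0 hA hB σ hσ hσ' => ?_⟩
  have key : ∀ (D : ℝ) (c : ℝ), 0 ≤ D →
      (∀ y : ℝ, ∫ t in T₀..T₁, ‖f ((c : ℂ) + ((t + y : ℝ) : ℂ) * I)‖ ^ 2 ≤ D * (1 + |y|) ^ k) →
      ∀ y : ℝ, Real.exp (-(2 * y ^ 2)) *
        ∫ t in T₀..T₁, ‖f ((c : ℂ) + ((t + y : ℝ) : ℂ) * I)‖ ^ 2 ≤ D * C := by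
    intro D c hD hy y
    calc _ ≤ Real.exp (-y ^ 2) * (D * (1 + |y|) ^ k) := by
          refine mul_le_mul (Real.exp_le_exp.2 ?_) (hy y)
            (intervalIntegral.integral_nonneg hT fun _ _ => by positivity) (by positivity)
          nlinarith [sq_nonneg y]
      _ = D * ((1 + |y|) ^ k * Real.exp (-y ^ 2)) := by ring
      _ ≤ _ := by gcongr; exact h y
  refine (integral_norm_sq_le_interp hf hab hpoly hT (key A a hA0 hA) (key B b hB0 hB)
    hσ hσ').trans_eq ?_
  rw [Real.mul_rpow hA0 hC.le, Real.mul_rpow hB0 hC.le]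
  set θ := (σ - a) / (b - a)
  have e : C ^ (1 - θ) * C ^ θ = C := by
    rw [← Real.rpow_add hC, sub_add_cancel, Real.rpow_one]
  calc _ = Real.exp (2 * (b - a) ^ 2) * (C ^ (1 - θ) * C ^ θ) * (A ^ (1 - θ) * B ^ θ) := by ring
    _ = _ := by rw [e]

theorem ofReal_add_mul_I_ne_one {c : ℝ} (hc : c ≠ 1) (t : ℝ) : (c : ℂ) + t * I ≠ 1 := by
  intro h
  have := congrArg re h
  simp at this
  exact hc this

theorem continuous_riemannZeta_line {c : ℝ} (hc : c ≠ 1) :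
    Continuous fun t : ℝ => riemannZeta ((c : ℂ) + t * I) := by
  rw [continuous_iff_continuousAt]
  intro t
  have h := (differentiableAt_riemannZeta (ofReal_add_mul_I_ne_one hc t)).continuousAt
  exact ContinuousAt.comp (g := riemannZeta) (f := fun t : ℝ => (c : ℂ) + t * I) h (by fun_prop)

theorem norm_line_sub_one_le (c : ℝ) {T t y : ℝ} (hT : 1 ≤ T) (ht : T ≤ t) (ht' : t ≤ 2 * T) :
    ‖(c : ℂ) + ((t + y : ℝ) : ℂ) * I - 1‖ ≤ (|c| + 3) * T * (1 + |y|) := by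
  have h1 : ‖(c : ℂ) + ((t + y : ℝ) : ℂ) * I - 1‖ ≤ |c| + |t + y| + 1 := by
    refine (norm_sub_le _ _).trans ?_
    rw [norm_one]
    gcongr
    refine (norm_add_le _ _).trans ?_
    rw [norm_mul, norm_I, norm_real, norm_real, mul_one, Real.norm_eq_abs, Real.norm_eq_abs]
  have h2 : |t + y| ≤ 2 * T + |y| := by
    refine (abs_add_le _ _).trans ?_
    rw [abs_of_nonneg (by linarith : 0 ≤ t)]
    linarith
  have h3 := abs_nonneg c
  have h4 := abs_nonneg y
  have h5 : |c| ≤ |c| * T := le_mul_of_one_le_right h3 hT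
  have h6 : |y| ≤ T * |y| := le_mul_of_one_le_left h4 hT
  have h7 : 0 ≤ |c| * T * |y| := by positivity
  nlinarith

theorem le_norm_line_sub_one (c t : ℝ) : |t| ≤ ‖(c : ℂ) + t * I - 1‖ := by
  have := abs_im_le_norm ((c : ℂ) + t * I - 1)
  simpa using this

theorem exists_integral_norm_riemannZeta₁_pow_le {c : ℝ} (hc : 1 / 4 ≤ c) (hc' : c < 1)
    {q C : ℝ} (hq : 0 ≤ q)
    (h : ∀ T : ℝ, 1 / 2 ≤ T → ∫ t in T..2 * T, ‖riemannZeta ((c : ℂ) + t * I)‖ ^ 4 ≤ C * T ^ q) :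
    ∃ C' > 0, ∀ T y : ℝ, 1 ≤ T →
      ∫ t in T..2 * T, ‖riemannZeta₁ ((c : ℂ) + ((t + y : ℝ) : ℂ) * I) ^ 2 / (T : ℂ) ^ 2‖ ^ 2 ≤
        C' * T ^ q * (1 + |y|) ^ 9 := by
  obtain ⟨D, hD, hpoly⟩ := exists_norm_riemannZeta₁_le
  have hcont := continuous_riemannZeta_line hc'.ne
  have hcont₁ := differentiable_riemannZeta₁.continuous
  have hC : 0 ≤ C := by
    have := h 1 (by norm_num)
    simp only [Real.one_rpow, mul_one] at this
    exact (intervalIntegral.integral_nonneg one_le_two fun _ _ => by positivity).trans this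
  refine ⟨4 ^ 4 * (3 * 2 ^ q * C) + 2 * D ^ 4 * 5 ^ 8, by positivity, fun T y hT => ?_⟩
  have hT0 : 0 < T := by linarith
  have hTq : 1 ≤ T ^ q := Real.one_le_rpow hT hq
  have hy0 := abs_nonneg y
  rcases le_or_gt |y| (T / 2) with hy | hy
  · have hy' := abs_le.1 hy
    have hpt : ∀ t ∈ Set.Icc T (2 * T),
        ‖riemannZeta₁ ((c : ℂ) + ((t + y : ℝ) : ℂ) * I) ^ 2 / (T : ℂ) ^ 2‖ ^ 2 ≤
        4 ^ 4 * (1 + |y|) ^ 4 * ‖riemannZeta ((c : ℂ) + ((t + y : ℝ) : ℂ) * I)‖ ^ 4 := by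
      intro t ht
      have hn := norm_line_sub_one_le c (y := y) hT ht.1 ht.2
      have hcabs : |c| ≤ 1 := abs_le.2 ⟨by linarith, hc'.le⟩
      have hn' : ‖(c : ℂ) + ((t + y : ℝ) : ℂ) * I - 1‖ ≤ T * (4 * (1 + |y|)) := by
        refine hn.trans ?_
        have : 0 ≤ T * (1 + |y|) := by positivity
        nlinarith
      rw [riemannZeta₁_eq_mul (ofReal_add_mul_I_ne_one hc'.ne _), norm_div, norm_pow, norm_mul,
        norm_pow, norm_real, Real.norm_of_nonneg hT0.le, div_pow, ← pow_mul, ← pow_mul,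
        div_le_iff₀ (by positivity), mul_pow]
      calc _ ≤ (T * (4 * (1 + |y|))) ^ (2 * 2) *
            ‖riemannZeta ((c : ℂ) + ((t + y : ℝ) : ℂ) * I)‖ ^ (2 * 2) := by gcongr
        _ = _ := by ring
    have hI : ∫ t in T..2 * T, ‖riemannZeta ((c : ℂ) + ((t + y : ℝ) : ℂ) * I)‖ ^ 4 ≤
        3 * 2 ^ q * C * T ^ q := by
      have hii : ∀ A B : ℝ, IntervalIntegrable
          (fun t : ℝ => ‖riemannZeta ((c : ℂ) + t * I)‖ ^ 4) MeasureTheory.volume A B :=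
        fun A B => Continuous.intervalIntegrable (by fun_prop) _ _
      have e1 := intervalIntegral.integral_comp_add_right (a := T) (b := 2 * T)
        (fun t : ℝ => ‖riemannZeta ((c : ℂ) + t * I)‖ ^ 4) y
      have e2 : ∫ t in T + y..2 * T + y, ‖riemannZeta ((c : ℂ) + t * I)‖ ^ 4 ≤
          ∫ t in T / 2..2 * (2 * T), ‖riemannZeta ((c : ℂ) + t * I)‖ ^ 4 :=
        intervalIntegral.integral_mono_interval (by linarith) (by linarith) (by linarith)
          (Filter.Eventually.of_forall fun _ => by positivity) (hii _ _)
      have h1 := h (T / 2) (by linarith)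
      have h2 := h T (by linarith)
      have h3 := h (2 * T) (by linarith)
      rw [mul_div_cancel₀ T two_ne_zero] at h1
      have e3 := intervalIntegral.integral_add_adjacent_intervals (hii (T / 2) T) (hii T (2 * T))
      have e4 := intervalIntegral.integral_add_adjacent_intervals (hii (T / 2) (2 * T))
        (hii (2 * T) (2 * (2 * T)))
      have h5 : (T / 2) ^ q ≤ (2 * T) ^ q := Real.rpow_le_rpow (by linarith) (by linarith) hq
      have h6 : T ^ q ≤ (2 * T) ^ q := Real.rpow_le_rpow (by linarith) (by linarith) hq
      have h7 : (2 * T) ^ q = 2 ^ q * T ^ q := Real.mul_rpow two_pos.le hT0.le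
      calc _ = ∫ t in T + y..2 * T + y, ‖riemannZeta ((c : ℂ) + t * I)‖ ^ 4 := e1
        _ ≤ C * (T / 2) ^ q + C * T ^ q + C * (2 * T) ^ q := by linarith
        _ ≤ C * (2 * T) ^ q + C * (2 * T) ^ q + C * (2 * T) ^ q := by gcongr
        _ = _ := by rw [h7]; ring
    calc _ ≤ ∫ t in T..2 * T, 4 ^ 4 * (1 + |y|) ^ 4 *
          ‖riemannZeta ((c : ℂ) + ((t + y : ℝ) : ℂ) * I)‖ ^ 4 := by
          refine intervalIntegral.integral_mono_on (by linarith)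
            (Continuous.intervalIntegrable (by fun_prop) _ _) ?_ hpt
          have : Continuous fun t : ℝ => riemannZeta ((c : ℂ) + ((t + y : ℝ) : ℂ) * I) :=
            hcont.comp (continuous_add_const y)
          exact Continuous.intervalIntegrable (by fun_prop) _ _
      _ = 4 ^ 4 * (1 + |y|) ^ 4 *
          ∫ t in T..2 * T, ‖riemannZeta ((c : ℂ) + ((t + y : ℝ) : ℂ) * I)‖ ^ 4 :=
          intervalIntegral.integral_const_mul _ _
      _ ≤ 4 ^ 4 * (1 + |y|) ^ 9 * (3 * 2 ^ q * C * T ^ q) := by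
          have h1 : (1 + |y|) ^ 4 ≤ (1 + |y|) ^ 9 := pow_le_pow_right₀ (by linarith) (by norm_num)
          have h2 : 0 ≤ ∫ t in T..2 * T, ‖riemannZeta ((c : ℂ) + ((t + y : ℝ) : ℂ) * I)‖ ^ 4 :=
            intervalIntegral.integral_nonneg (by linarith) fun _ _ => by positivity
          gcongr
      _ = (4 ^ 4 * (3 * 2 ^ q * C)) * T ^ q * (1 + |y|) ^ 9 := by ring
      _ ≤ _ := by
          gcongr
          exact le_add_of_nonneg_right (by positivity)
  · have hpt : ∀ t ∈ Set.Icc T (2 * T),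
        ‖riemannZeta₁ ((c : ℂ) + ((t + y : ℝ) : ℂ) * I) ^ 2 / (T : ℂ) ^ 2‖ ^ 2 ≤
        D ^ 4 * 5 ^ 8 * (1 + |y|) ^ 8 := by
      intro t ht
      have h1 : ‖riemannZeta₁ ((c : ℂ) + ((t + y : ℝ) : ℂ) * I)‖ ≤ D * (5 * (1 + |y|)) ^ 2 := by
        refine (hpoly _ (by simpa using hc)).trans ?_
        gcongr
        have : ‖(c : ℂ) + ((t + y : ℝ) : ℂ) * I‖ ≤ |c| + |t + y| := by
          refine (norm_add_le _ _).trans ?_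
          rw [norm_mul, norm_I, norm_real, norm_real, mul_one, Real.norm_eq_abs, Real.norm_eq_abs]
        have h2 : |t + y| ≤ 2 * T + |y| := by
          refine (abs_add_le _ _).trans ?_
          rw [abs_of_nonneg (by linarith [ht.1] : 0 ≤ t)]
          linarith [ht.2]
        have hcabs : |c| ≤ 1 := abs_le.2 ⟨by linarith, hc'.le⟩
        linarith
      rw [norm_div, norm_pow, norm_pow, norm_real, Real.norm_of_nonneg hT0.le]
      calc _ ≤ (‖riemannZeta₁ ((c : ℂ) + ((t + y : ℝ) : ℂ) * I)‖ ^ 2) ^ 2 := by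
            gcongr
            exact div_le_self (by positivity) (one_le_pow₀ hT)
        _ ≤ ((D * (5 * (1 + |y|)) ^ 2) ^ 2) ^ 2 := by gcongr
        _ = _ := by ring
    calc _ ≤ ∫ t in T..2 * T, D ^ 4 * 5 ^ 8 * (1 + |y|) ^ 8 :=
          intervalIntegral.integral_mono_on (by linarith)
            (Continuous.intervalIntegrable (by fun_prop) _ _) (by simp) hpt
      _ = T * (D ^ 4 * 5 ^ 8 * (1 + |y|) ^ 8) := by
          rw [intervalIntegral.integral_const, smul_eq_mul]; ring
      _ ≤ 2 * (1 + |y|) * (D ^ 4 * 5 ^ 8 * (1 + |y|) ^ 8) := by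
          gcongr
          linarith
      _ = 2 * D ^ 4 * 5 ^ 8 * 1 * (1 + |y|) ^ 9 := by ring
      _ ≤ _ := by
          gcongr
          exact le_add_of_nonneg_left (by positivity)

theorem differentiable_divisorSum (T : ℝ) : Differentiable ℂ (divisorSum T) := by
  unfold divisorSum
  refine Differentiable.fun_sum fun n hn => (differentiable_const _).mul ?_
  have : (n : ℂ) ≠ 0 := by
    have := (mem_Icc.1 hn).1
    exact_mod_cast (by omega : n ≠ 0)
  exact Differentiable.const_cpow (by fun_prop) (Or.inl this)

theorem exists_norm_divisorSum_le (T c : ℝ) :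
    ∃ Q > 0, ∀ s : ℂ, c ≤ s.re → ‖divisorSum T s‖ ≤ Q := by
  refine ⟨∑ n ∈ Icc 1 ⌊T⌋₊, (#n.divisors : ℝ) * (n : ℝ) ^ (-c) + 1, by positivity, fun s hs => ?_⟩
  refine (norm_sum_le _ _).trans ((sum_le_sum fun n hn => ?_).trans (le_add_of_nonneg_right one_pos.le))
  have h1 := (mem_Icc.1 hn).1
  rw [norm_mul, Complex.norm_natCast, norm_natCast_cpow_of_pos (by omega), neg_re]
  gcongr
  exact_mod_cast h1

/-- The difference between the squared zeta function and its truncated Dirichlet series, made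
entire and normalised at height `T`. -/
noncomputable def zetaSqRemainder (T : ℝ) (s : ℂ) : ℂ :=
  riemannZeta₁ s ^ 2 / (T : ℂ) ^ 2 - (s - 1) ^ 2 / (T : ℂ) ^ 2 * divisorSum T s

theorem differentiable_zetaSqRemainder (T : ℝ) : Differentiable ℂ (zetaSqRemainder T) := by
  have h1 := differentiable_divisorSum T
  have h2 := differentiable_riemannZeta₁
  unfold zetaSqRemainder
  fun_prop

theorem zetaSqRemainder_eq (T : ℝ) {s : ℂ} (hs : s ≠ 1) :
    zetaSqRemainder T s = (s - 1) ^ 2 / (T : ℂ) ^ 2 * (riemannZeta s ^ 2 - divisorSum T s) := by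
  rw [zetaSqRemainder, riemannZeta₁_eq_mul hs]
  ring

theorem exists_norm_zetaSqRemainder_le {T c : ℝ} (hT : 1 ≤ T) (hc : 1 / 4 ≤ c) :
    ∃ K, ∀ s : ℂ, c ≤ s.re → ‖zetaSqRemainder T s‖ ≤ K * (1 + ‖s‖) ^ 4 := by
  obtain ⟨D, hD, hpoly⟩ := exists_norm_riemannZeta₁_le
  obtain ⟨Q, hQ, hdiv⟩ := exists_norm_divisorSum_le T c
  refine ⟨D ^ 2 + Q, fun s hs => ?_⟩
  have hT2 : 1 ≤ ‖(T : ℂ) ^ 2‖ := by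
    rw [norm_pow, norm_real, Real.norm_of_nonneg (by linarith)]
    exact one_le_pow₀ hT
  have h1 : ‖riemannZeta₁ s ^ 2 / (T : ℂ) ^ 2‖ ≤ D ^ 2 * (1 + ‖s‖) ^ 4 := by
    rw [norm_div]
    refine (div_le_self (norm_nonneg _) hT2).trans ?_
    rw [norm_pow]
    calc _ ≤ (D * (1 + ‖s‖) ^ 2) ^ 2 := by
          gcongr
          exact hpoly s (hc.trans hs)
      _ = _ := by ring
  have h2 : ‖(s - 1) ^ 2 / (T : ℂ) ^ 2 * divisorSum T s‖ ≤ Q * (1 + ‖s‖) ^ 4 := by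
    rw [norm_mul, mul_comm]
    gcongr
    · exact hdiv s hs
    · rw [norm_div]
      refine (div_le_self (norm_nonneg _) hT2).trans ?_
      rw [norm_pow]
      calc ‖s - 1‖ ^ 2 ≤ (1 + ‖s‖) ^ 2 := by
            gcongr
            refine (norm_sub_le _ _).trans ?_
            rw [norm_one, add_comm]
        _ ≤ _ := pow_le_pow_right₀ (by linarith [norm_nonneg s]) (by norm_num)
  rw [add_mul]
  exact (norm_sub_le _ _).trans (add_le_add h1 h2)

theorem norm_line_factor_mul_sq_le (c : ℝ) {T t : ℝ} (y : ℝ) (hT : 1 ≤ T) (ht : T ≤ t)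
    (ht' : t ≤ 2 * T) (w : ℂ) :
    ‖((c : ℂ) + ((t + y : ℝ) : ℂ) * I - 1) ^ 2 / (T : ℂ) ^ 2 * w‖ ^ 2 ≤
      (|c| + 3) ^ 4 * (1 + |y|) ^ 4 * ‖w‖ ^ 2 := by
  have hT0 : 0 < T := by linarith
  have hn := norm_line_sub_one_le c (y := y) hT ht ht'
  have h1 : ‖(c : ℂ) + ((t + y : ℝ) : ℂ) * I - 1‖ / T ≤ (|c| + 3) * (1 + |y|) := by
    rw [div_le_iff₀ hT0]
    linarith
  rw [norm_mul, norm_div, norm_pow, norm_pow, norm_real, Real.norm_of_nonneg hT0.le, ← div_pow,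
    mul_pow, ← pow_mul]
  calc _ ≤ ((|c| + 3) * (1 + |y|)) ^ (2 * 2) * ‖w‖ ^ 2 := by gcongr
    _ = _ := by ring

theorem integral_comp_add_line (g : ℂ → ℝ) (c T y : ℝ) :
    ∫ t in T..2 * T, g ((c : ℂ) + ((t + y : ℝ) : ℂ) * I) =
      ∫ t in (T + y)..(2 * T + y), g ((c : ℂ) + t * I) :=
  intervalIntegral.integral_comp_add_right (fun t : ℝ => g ((c : ℂ) + t * I)) y

theorem exists_integral_zetaSqRemainder_right_le {δ : ℝ} (hδ : 0 < δ) (hδ' : δ ≤ 1 / 8) :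
    ∃ C > 0, ∀ T y : ℝ, 1 ≤ T →
      ∫ t in T..2 * T, ‖zetaSqRemainder T (((4 : ℝ) : ℂ) + ((t + y : ℝ) : ℂ) * I)‖ ^ 2 ≤
        C * T ^ (-6 + δ) * (1 + |y|) ^ 9 := by
  obtain ⟨C, hC, h⟩ := exists_integral_riemannZeta_sq_sub_divisorSum_sq_le hδ hδ'
  refine ⟨7 ^ 4 * C, by positivity, fun T y hT => ?_⟩
  have hy0 := abs_nonneg y
  have hc4 : (4 : ℝ) ≠ 1 := by norm_num
  have hz := continuous_riemannZeta_line hc4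
  have hd := (differentiable_divisorSum T).continuous
  have hr := (differentiable_zetaSqRemainder T).continuous
  have hz' : Continuous fun t : ℝ => riemannZeta (((4 : ℝ) : ℂ) + ((t + y : ℝ) : ℂ) * I) :=
    hz.comp (continuous_add_const y)
  have hI := h T (T + y) (2 * T + y) hT (by linarith) (by linarith)
  rw [← integral_comp_add_line (fun s => ‖riemannZeta s ^ 2 - divisorSum T s‖ ^ 2)] at hI
  calc _ ≤ ∫ t in T..2 * T, (|(4 : ℝ)| + 3) ^ 4 * (1 + |y|) ^ 4 *
        ‖riemannZeta (((4 : ℝ) : ℂ) + ((t + y : ℝ) : ℂ) * I) ^ 2 -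
          divisorSum T (((4 : ℝ) : ℂ) + ((t + y : ℝ) : ℂ) * I)‖ ^ 2 := by
        refine intervalIntegral.integral_mono_on (by linarith)
          (Continuous.intervalIntegrable (by fun_prop) _ _)
          (Continuous.intervalIntegrable (by fun_prop) _ _) fun t ht => ?_
        rw [zetaSqRemainder_eq T (ofReal_add_mul_I_ne_one hc4 _)]
        exact norm_line_factor_mul_sq_le 4 y hT ht.1 ht.2 _
    _ = (|(4 : ℝ)| + 3) ^ 4 * (1 + |y|) ^ 4 * ∫ t in T..2 * T,
        ‖riemannZeta (((4 : ℝ) : ℂ) + ((t + y : ℝ) : ℂ) * I) ^ 2 -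
          divisorSum T (((4 : ℝ) : ℂ) + ((t + y : ℝ) : ℂ) * I)‖ ^ 2 :=
        intervalIntegral.integral_const_mul _ _
    _ ≤ (|(4 : ℝ)| + 3) ^ 4 * (1 + |y|) ^ 9 * (C * T ^ (-6 + δ)) := by
        refine mul_le_mul ?_ hI
          (intervalIntegral.integral_nonneg (by linarith) fun _ _ => by positivity) (by positivity)
        exact mul_le_mul_of_nonneg_left (pow_le_pow_right₀ (by linarith) (by norm_num))
          (by positivity)
    _ = _ := by
        rw [abs_of_pos four_pos]; ring

theorem exists_integral_norm_riemannZeta_left_pow_le {δ : ℝ} (hδ : 0 < δ) (hδ' : δ ≤ 1 / 8)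
    {κ C : ℝ} (h : ∀ T : ℝ, 1 / 2 ≤ T →
      ∫ t in T..2 * T, ‖riemannZeta (((1 / 2 + δ : ℝ) : ℂ) + t * I)‖ ^ 4 ≤ C * T ^ κ) :
    ∃ C', ∀ T : ℝ, 1 / 2 ≤ T →
      ∫ t in T..2 * T, ‖riemannZeta (((1 / 2 - δ : ℝ) : ℂ) + t * I)‖ ^ 4 ≤
        C' * T ^ (κ + 4 * δ) := by
  obtain ⟨D, hD, hrefl⟩ := exists_norm_riemannZeta_reflect_le hδ (by linarith)
  refine ⟨(D * 4 ^ δ) ^ 4 * C, fun T hT => ?_⟩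
  have hT0 : 0 < T := by linarith
  have hz := continuous_riemannZeta_line (c := 1 / 2 + δ) (by linarith)
  have hz' := continuous_riemannZeta_line (c := 1 / 2 - δ) (by linarith)
  calc _ ≤ ∫ t in T..2 * T, (D * 4 ^ δ) ^ 4 * T ^ (4 * δ) *
        ‖riemannZeta (((1 / 2 + δ : ℝ) : ℂ) + t * I)‖ ^ 4 := by
        refine intervalIntegral.integral_mono_on (by linarith)
          (Continuous.intervalIntegrable (by fun_prop) _ _)
          (Continuous.intervalIntegrable (by fun_prop) _ _) fun t ht => ?_
        have h1 : (1 + t) ^ δ ≤ 4 ^ δ * T ^ δ := by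
          rw [← Real.mul_rpow (by norm_num) hT0.le]
          exact Real.rpow_le_rpow (by linarith [ht.1]) (by linarith [ht.2]) hδ.le
        have h2 : (T ^ δ) ^ 4 = T ^ (4 * δ) := by
          rw [← Real.rpow_natCast, ← Real.rpow_mul hT0.le]
          congr 1; push_cast; ring
        have h3 : 0 ≤ t := by linarith [ht.1]
        calc _ ≤ (D * (1 + t) ^ δ * ‖riemannZeta (((1 / 2 + δ : ℝ) : ℂ) + t * I)‖) ^ 4 := by
              gcongr
              exact hrefl t h3
          _ ≤ (D * (4 ^ δ * T ^ δ) * ‖riemannZeta (((1 / 2 + δ : ℝ) : ℂ) + t * I)‖) ^ 4 := by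
              gcongr
          _ = _ := by rw [← h2]; ring
    _ = (D * 4 ^ δ) ^ 4 * T ^ (4 * δ) *
        ∫ t in T..2 * T, ‖riemannZeta (((1 / 2 + δ : ℝ) : ℂ) + t * I)‖ ^ 4 :=
        intervalIntegral.integral_const_mul _ _
    _ ≤ (D * 4 ^ δ) ^ 4 * T ^ (4 * δ) * (C * T ^ κ) := by
        gcongr
        exact h T hT
    _ = _ := by rw [Real.rpow_add hT0]; ring

theorem exists_integral_zetaSqRemainder_left_le {δ : ℝ} (hδ : 0 < δ) (hδ' : δ ≤ 1 / 8)
    {κ C : ℝ} (hκ : 1 ≤ κ) (h : ∀ T : ℝ, 1 / 2 ≤ T →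
      ∫ t in T..2 * T, ‖riemannZeta (((1 / 2 + δ : ℝ) : ℂ) + t * I)‖ ^ 4 ≤ C * T ^ κ) :
    ∃ C' > 0, ∀ T y : ℝ, 1 ≤ T →
      ∫ t in T..2 * T, ‖zetaSqRemainder T (((1 / 2 - δ : ℝ) : ℂ) + ((t + y : ℝ) : ℂ) * I)‖ ^ 2 ≤
        C' * T ^ (κ + 4 * δ) * (1 + |y|) ^ 9 := by
  obtain ⟨C₁, h₁⟩ := exists_integral_norm_riemannZeta_left_pow_le hδ hδ' h
  obtain ⟨C₂, hC₂, h₂⟩ := exists_integral_norm_riemannZeta₁_pow_le (c := 1 / 2 - δ)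
    (by linarith) (by linarith) (q := κ + 4 * δ) (by linarith) h₁
  obtain ⟨C₃, hC₃, h₃⟩ := exists_integral_divisorSum_left_sq_le hδ hδ'
  set a : ℝ := 1 / 2 - δ with ha
  refine ⟨2 * C₂ + 2 * (|a| + 3) ^ 4 * C₃, by positivity, fun T y hT => ?_⟩
  have hT0 : 0 < T := by linarith
  have hy0 := abs_nonneg y
  have hd := (differentiable_divisorSum T).continuous
  have hr := (differentiable_zetaSqRemainder T).continuous
  have hz₁ := differentiable_riemannZeta₁.continuous
  have hI := h₃ T (T + y) (2 * T + y) hT (by linarith) (by linarith)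
  rw [← integral_comp_add_line (fun s => ‖divisorSum T s‖ ^ 2)] at hI
  have hI0 : 0 ≤ ∫ t in T..2 * T, ‖divisorSum T ((a : ℂ) + ((t + y : ℝ) : ℂ) * I)‖ ^ 2 :=
    intervalIntegral.integral_nonneg (by linarith) fun _ _ => by positivity
  calc _ ≤ ∫ t in T..2 * T, (2 * ‖riemannZeta₁ ((a : ℂ) + ((t + y : ℝ) : ℂ) * I) ^ 2 /
          (T : ℂ) ^ 2‖ ^ 2 + 2 * (|a| + 3) ^ 4 * (1 + |y|) ^ 4 *
            ‖divisorSum T ((a : ℂ) + ((t + y : ℝ) : ℂ) * I)‖ ^ 2) := by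
        refine intervalIntegral.integral_mono_on (by linarith)
          (Continuous.intervalIntegrable (by fun_prop) _ _)
          (Continuous.intervalIntegrable (by fun_prop) _ _) fun t ht => ?_
        have h5 := norm_line_factor_mul_sq_le a y hT ht.1 ht.2
          (divisorSum T ((a : ℂ) + ((t + y : ℝ) : ℂ) * I))
        rw [zetaSqRemainder]
        set u := riemannZeta₁ ((a : ℂ) + ((t + y : ℝ) : ℂ) * I) ^ 2 / (T : ℂ) ^ 2
        set v := ((a : ℂ) + ((t + y : ℝ) : ℂ) * I - 1) ^ 2 / (T : ℂ) ^ 2 *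
          divisorSum T ((a : ℂ) + ((t + y : ℝ) : ℂ) * I)
        have h6 : ‖u - v‖ ^ 2 ≤ (‖u‖ + ‖v‖) ^ 2 := by
          gcongr
          exact norm_sub_le _ _
        nlinarith [sq_nonneg (‖u‖ - ‖v‖)]
    _ = 2 * (∫ t in T..2 * T, ‖riemannZeta₁ ((a : ℂ) + ((t + y : ℝ) : ℂ) * I) ^ 2 /
          (T : ℂ) ^ 2‖ ^ 2) + 2 * (|a| + 3) ^ 4 * (1 + |y|) ^ 4 *
          ∫ t in T..2 * T, ‖divisorSum T ((a : ℂ) + ((t + y : ℝ) : ℂ) * I)‖ ^ 2 := by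
        rw [intervalIntegral.integral_add (Continuous.intervalIntegrable (by fun_prop) _ _)
          (Continuous.intervalIntegrable (by fun_prop) _ _), intervalIntegral.integral_const_mul,
          intervalIntegral.integral_const_mul]
    _ ≤ 2 * (C₂ * T ^ (κ + 4 * δ) * (1 + |y|) ^ 9) + 2 * (|a| + 3) ^ 4 * (1 + |y|) ^ 9 *
          (C₃ * T ^ (κ + 4 * δ)) := by
        have h7 : (1 + |y|) ^ 4 ≤ (1 + |y|) ^ 9 := pow_le_pow_right₀ (by linarith) (by norm_num)
        have h8 : T ^ (1 + 3 * δ) ≤ T ^ (κ + 4 * δ) :=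
          Real.rpow_le_rpow_of_exponent_le hT (by linarith)
        refine add_le_add (mul_le_mul_of_nonneg_left (h₂ T y hT) two_pos.le) ?_
        refine mul_le_mul ?_ (hI.trans ?_) hI0 (by positivity)
        · gcongr
        · gcongr
    _ = _ := by ring

theorem exists_integral_norm_riemannZeta_pow_four_le_pow {α : ℝ} (hα : 1 / 4 ≤ α) (hα' : α < 1) :
    ∃ C > 0, ∀ T : ℝ, 1 / 2 ≤ T →
      ∫ t in T..2 * T, ‖riemannZeta ((α : ℂ) + t * I)‖ ^ 4 ≤ C * T ^ (9 : ℝ) := by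
  obtain ⟨C, hC, h⟩ := exists_norm_riemannZeta₁_le
  refine ⟨(2 * C * 36) ^ 4, by positivity, fun T hT => ?_⟩
  have hc := continuous_riemannZeta_line hα'.ne
  have hT0 : 0 < T := by linarith
  calc _ ≤ ∫ t in T..2 * T, (2 * C * 36) ^ 4 * T ^ 8 := by
        refine intervalIntegral.integral_mono_on (by linarith)
          (Continuous.intervalIntegrable (by fun_prop) _ _) (by simp) fun t ht => ?_
        have h1 : (1 / 2 : ℝ) ≤ ‖(α : ℂ) + t * I - 1‖ :=
          le_trans (hT.trans (ht.1.trans (le_abs_self t))) (le_norm_line_sub_one α t)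
        have h2 := h ((α : ℂ) + t * I) (by simpa using hα)
        rw [riemannZeta₁_eq_mul (ofReal_add_mul_I_ne_one hα'.ne t), norm_mul] at h2
        have h3 : ‖(α : ℂ) + t * I‖ ≤ 1 + 2 * T := by
          refine (norm_add_le _ _).trans ?_
          rw [norm_mul, Complex.norm_I, mul_one, Complex.norm_real, Complex.norm_real,
            Real.norm_of_nonneg (by linarith), Real.norm_of_nonneg (by linarith [ht.1])]
          linarith [ht.2]
        have h4 : (1 + ‖(α : ℂ) + t * I‖) ^ 2 ≤ (6 * T) ^ 2 := by
          gcongr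
          linarith
        have h5 : ‖riemannZeta ((α : ℂ) + t * I)‖ ≤ 2 * C * 36 * T ^ 2 := by
          have h6 := mul_le_mul_of_nonneg_right h1 (norm_nonneg (riemannZeta ((α : ℂ) + t * I)))
          nlinarith
        calc _ ≤ (2 * C * 36 * T ^ 2) ^ 4 := by gcongr
          _ = _ := by ring
    _ = _ := by
        rw [intervalIntegral.integral_const, smul_eq_mul]
        norm_cast
        ring

theorem norm_riemannZeta_pow_four_le {δ : ℝ} (hδ : δ < 1 / 2) {T t : ℝ} (hT : 0 < T) (ht : T ≤ t) :
    ‖riemannZeta (((1 / 2 + δ : ℝ) : ℂ) + t * I)‖ ^ 4 ≤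
      2 * ‖zetaSqRemainder T (((1 / 2 + δ : ℝ) : ℂ) + t * I)‖ ^ 2 +
        2 * ‖divisorSum T (((1 / 2 + δ : ℝ) : ℂ) + t * I)‖ ^ 2 := by
  have hs := ofReal_add_mul_I_ne_one (c := 1 / 2 + δ) (by linarith) t
  have h1 : T ≤ ‖((1 / 2 + δ : ℝ) : ℂ) + t * I - 1‖ :=
    (ht.trans (le_abs_self t)).trans (le_norm_line_sub_one _ t)
  rw [zetaSqRemainder_eq T hs]
  set s := ((1 / 2 + δ : ℝ) : ℂ) + t * I
  have h2 : ‖riemannZeta s ^ 2 - divisorSum T s‖ ≤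
      ‖(s - 1) ^ 2 / (T : ℂ) ^ 2 * (riemannZeta s ^ 2 - divisorSum T s)‖ := by
    rw [norm_mul, norm_div, norm_pow, norm_pow, Complex.norm_real, Real.norm_of_nonneg hT.le]
    refine le_mul_of_one_le_left (norm_nonneg _) ?_
    rw [one_le_div (by positivity)]
    gcongr
  have h3 : ‖riemannZeta s ^ 2‖ ≤ ‖riemannZeta s ^ 2 - divisorSum T s‖ + ‖divisorSum T s‖ := by
    linarith [norm_sub_norm_le (riemannZeta s ^ 2) (divisorSum T s)]
  set v := ‖(s - 1) ^ 2 / (T : ℂ) ^ 2 * (riemannZeta s ^ 2 - divisorSum T s)‖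
  have h4 : ‖riemannZeta s‖ ^ 4 ≤ (v + ‖divisorSum T s‖) ^ 2 := by
    have : ‖riemannZeta s‖ ^ 4 = ‖riemannZeta s ^ 2‖ ^ 2 := by rw [norm_pow]; ring
    rw [this]
    gcongr
    linarith
  nlinarith [sq_nonneg (v - ‖divisorSum T s‖)]

theorem exists_integral_norm_riemannZeta_pow_four_le_step {δ : ℝ} (hδ : 0 < δ) (hδ' : δ ≤ 1 / 8)
    {κ C : ℝ} (hκ : 1 ≤ κ) (h : ∀ T : ℝ, 1 / 2 ≤ T →
      ∫ t in T..2 * T, ‖riemannZeta (((1 / 2 + δ : ℝ) : ℂ) + t * I)‖ ^ 4 ≤ C * T ^ κ) :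
    ∃ C', ∀ T : ℝ, 1 / 2 ≤ T →
      ∫ t in T..2 * T, ‖riemannZeta (((1 / 2 + δ : ℝ) : ℂ) + t * I)‖ ^ 4 ≤
        C' * T ^ max (κ - δ * (2 * δ / (7 / 2 + δ))) 1 := by
  obtain ⟨C₁, hC₁, h₁⟩ := exists_integral_zetaSqRemainder_left_le hδ hδ' hκ h
  obtain ⟨C₂, hC₂, h₂⟩ := exists_integral_zetaSqRemainder_right_le hδ hδ'
  obtain ⟨C₃, hC₃, h₃⟩ := exists_integral_divisorSum_sq_le hδ hδ'
  obtain ⟨C₄, hC₄, h₄⟩ := exists_integral_norm_sq_le_interp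
    (a := 1 / 2 - δ) (b := 4) (by linarith) 9
  set θ : ℝ := 2 * δ / (7 / 2 + δ) with hθ
  have hθ0 : 0 < θ := by positivity
  have hθe : θ * (7 / 2 + δ) = 2 * δ := by rw [hθ]; field_simp
  have hθ' : ((1 / 2 + δ) - (1 / 2 - δ)) / (4 - (1 / 2 - δ)) = θ := by
    rw [hθ]; congr 1 <;> ring
  set κ' := max (κ - δ * θ) 1 with hκ'
  have hκ1 : 1 ≤ κ' := le_max_right _ _
  set D := 2 * (C₄ * (C₁ ^ (1 - θ) * C₂ ^ θ)) + 2 * C₃ with hD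
  have hD0 : 0 < D := by positivity
  refine ⟨D + |C| * 2 ^ κ', fun T hT => ?_⟩
  have hT0 : 0 < T := by linarith
  have hz := continuous_riemannZeta_line (c := 1 / 2 + δ) (by linarith)
  rcases le_or_gt 1 T with hT1 | hT1
  · have hd := (differentiable_divisorSum T).continuous
    have hr := (differentiable_zetaSqRemainder T).continuous
    obtain ⟨K, hK⟩ := exists_norm_zetaSqRemainder_le hT1 (c := 1 / 2 - δ) (by linarith)
    have h5 := h₄ (zetaSqRemainder T) (differentiable_zetaSqRemainder T) K 4
      (fun s hs _ => hK s hs) T (2 * T) (C₁ * T ^ (κ + 4 * δ)) (C₂ * T ^ (-6 + δ)) (by linarith)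
      (by positivity) (by positivity) (fun y => h₁ T y hT1) (fun y => h₂ T y hT1)
      (1 / 2 + δ) (by linarith) (by linarith)
    rw [hθ', Real.mul_rpow hC₁.le (by positivity), Real.mul_rpow hC₂.le (by positivity),
      ← Real.rpow_mul hT0.le, ← Real.rpow_mul hT0.le] at h5
    have h6 : T ^ ((κ + 4 * δ) * (1 - θ)) * T ^ ((-6 + δ) * θ) ≤ T ^ κ' := by
      rw [← Real.rpow_add hT0]
      refine Real.rpow_le_rpow_of_exponent_le hT1 (le_trans ?_ (le_max_left _ _))
      nlinarith [mul_le_mul_of_nonneg_left hκ hθ0.le]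
    have h7 := h₃ T T (2 * T) hT1 (by linarith) (by linarith)
    have h8 : T ≤ T ^ κ' := by
      simpa using Real.rpow_le_rpow_of_exponent_le hT1 hκ1
    calc _ ≤ ∫ t in T..2 * T, (2 * ‖zetaSqRemainder T (((1 / 2 + δ : ℝ) : ℂ) + t * I)‖ ^ 2 +
          2 * ‖divisorSum T (((1 / 2 + δ : ℝ) : ℂ) + t * I)‖ ^ 2) :=
          intervalIntegral.integral_mono_on (by linarith)
            (Continuous.intervalIntegrable (by fun_prop) _ _)
            (Continuous.intervalIntegrable (by fun_prop) _ _) fun t ht =>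
              norm_riemannZeta_pow_four_le (by linarith) hT0 ht.1
      _ = 2 * (∫ t in T..2 * T, ‖zetaSqRemainder T (((1 / 2 + δ : ℝ) : ℂ) + t * I)‖ ^ 2) +
          2 * ∫ t in T..2 * T, ‖divisorSum T (((1 / 2 + δ : ℝ) : ℂ) + t * I)‖ ^ 2 := by
          rw [intervalIntegral.integral_add (Continuous.intervalIntegrable (by fun_prop) _ _)
            (Continuous.intervalIntegrable (by fun_prop) _ _), intervalIntegral.integral_const_mul,
            intervalIntegral.integral_const_mul]
      _ ≤ 2 * (C₄ * (C₁ ^ (1 - θ) * C₂ ^ θ) * T ^ κ') + 2 * (C₃ * T ^ κ') := by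
          refine add_le_add (mul_le_mul_of_nonneg_left (h5.trans ?_) two_pos.le)
            (mul_le_mul_of_nonneg_left (h7.trans (by gcongr)) two_pos.le)
          calc _ = C₄ * (C₁ ^ (1 - θ) * C₂ ^ θ) *
                (T ^ ((κ + 4 * δ) * (1 - θ)) * T ^ ((-6 + δ) * θ)) := by ring
            _ ≤ _ := by gcongr
      _ = D * T ^ κ' := by rw [hD]; ring
      _ ≤ _ := by
          gcongr
          have : 0 ≤ |C| * 2 ^ κ' := by positivity
          linarith
  · calc _ ≤ C * T ^ κ := h T hT
      _ ≤ |C| * 1 := mul_le_mul (le_abs_self C) (Real.rpow_le_one hT0.le hT1.le (by linarith))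
          (by positivity) (abs_nonneg C)
      _ ≤ |C| * (2 * T) ^ κ' := by
          gcongr
          exact Real.one_le_rpow (by linarith) (by linarith)
      _ = |C| * 2 ^ κ' * T ^ κ' := by rw [Real.mul_rpow two_pos.le hT0.le]; ring
      _ ≤ _ := by
          gcongr
          linarith

theorem exists_integral_norm_riemannZeta_pow_four_le {δ : ℝ} (hδ : 0 < δ) (hδ' : δ ≤ 1 / 8) :
    ∃ C, ∀ T : ℝ, 1 / 2 ≤ T →
      ∫ t in T..2 * T, ‖riemannZeta (((1 / 2 + δ : ℝ) : ℂ) + t * I)‖ ^ 4 ≤ C * T := by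
  set g := δ * (2 * δ / (7 / 2 + δ)) with hg
  have hg0 : 0 < g := by positivity
  have key (n : ℕ) : ∃ C, ∀ T : ℝ, 1 / 2 ≤ T →
      ∫ t in T..2 * T, ‖riemannZeta (((1 / 2 + δ : ℝ) : ℂ) + t * I)‖ ^ 4 ≤
        C * T ^ max (9 - n * g) 1 := by
    induction n with
    | zero =>
      obtain ⟨C, -, hC⟩ := exists_integral_norm_riemannZeta_pow_four_le_pow (α := 1 / 2 + δ)
        (by linarith) (by linarith)
      refine ⟨C, fun T hT => ?_⟩
      convert hC T hT using 2
      norm_num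
    | succ n ih =>
      obtain ⟨C, hC⟩ := ih
      obtain ⟨C', hC'⟩ := exists_integral_norm_riemannZeta_pow_four_le_step hδ hδ'
        (le_max_right _ _) hC
      refine ⟨C', fun T hT => ?_⟩
      convert hC' T hT using 3
      rw [← hg, ← max_sub_sub_right, max_assoc, max_eq_right (a := 1 - g) (by linarith)]
      push_cast
      ring_nf
  obtain ⟨n, hn⟩ := exists_nat_gt (9 / g)
  obtain ⟨C, hC⟩ := key n
  refine ⟨C, fun T hT => ?_⟩
  have h1 := hC T hT
  rwa [max_eq_right, Real.rpow_one] at h1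
  rw [div_lt_iff₀ hg0] at hn
  linarith

theorem intervalIntegral_mono_of_nonneg {f g : ℝ → ℝ} {a b : ℝ} (hab : a ≤ b)
    (hg : IntervalIntegrable g MeasureTheory.volume a b)
    (h : ∀ t ∈ Set.Ioc a b, 0 ≤ f t ∧ f t ≤ g t) :
    ∫ t in a..b, f t ≤ ∫ t in a..b, g t := by
  rw [intervalIntegral.integral_of_le hab, intervalIntegral.integral_of_le hab]
  refine MeasureTheory.integral_mono_of_nonneg ?_ hg.1 ?_
  · filter_upwards [MeasureTheory.ae_restrict_mem measurableSet_Ioc] with t ht using (h t ht).1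
  · filter_upwards [MeasureTheory.ae_restrict_mem measurableSet_Ioc] with t ht using (h t ht).2

theorem norm_riemannZeta_le_norm_riemannZeta_re {s : ℂ} (hs : 1 < s.re) :
    ‖riemannZeta s‖ ≤ ‖riemannZeta s.re‖ := by
  have hn (n : ℕ) : ‖1 / (n : ℂ) ^ s‖ = 1 / (n : ℝ) ^ s.re := by
    rw [norm_div, norm_one, Complex.norm_natCast_cpow_of_re_ne_zero n (by linarith)]
  have h2 : Summable fun n : ℕ => 1 / (n : ℝ) ^ s.re := Real.summable_one_div_nat_rpow.2 hs
  have h3 : riemannZeta s.re = ((∑' n : ℕ, 1 / (n : ℝ) ^ s.re : ℝ) : ℂ) := by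
    rw [zeta_eq_tsum_one_div_nat_cpow (by simpa using hs), Complex.ofReal_tsum]
    refine tsum_congr fun n => ?_
    rw [Complex.ofReal_div, Complex.ofReal_one, Complex.ofReal_cpow n.cast_nonneg,
      Complex.ofReal_natCast]
  rw [h3, Complex.norm_real, zeta_eq_tsum_one_div_nat_cpow hs]
  refine (norm_tsum_le_tsum_norm (by simpa only [hn] using h2)).trans ?_
  simp only [hn]
  exact le_abs_self _

theorem exists_integral_norm_riemannZeta_pow_four_le_uniform {δ : ℝ} (hδ : 0 < δ)
    (hδ' : δ ≤ 1 / 8) {b : ℝ} (hb : 1 < b) :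
    ∃ C > 0, ∀ T : ℝ, 1 ≤ T → ∀ σ : ℝ, 1 / 2 + δ ≤ σ → σ ≤ b →
      ∫ t in T..2 * T, ‖riemannZeta ((σ : ℂ) + t * I)‖ ^ 4 ≤ C * T := by
  obtain ⟨C₁, h₁⟩ := exists_integral_norm_riemannZeta_pow_four_le hδ hδ'
  obtain ⟨C₂, hC₂, h₂⟩ := exists_integral_norm_riemannZeta₁_pow_le (c := 1 / 2 + δ)
    (by linarith) (by linarith) (q := 1) (C := C₁) zero_le_one (by simpa using h₁)
  obtain ⟨C₃, hC₃, h₃⟩ := exists_norm_riemannZeta₁_le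
  obtain ⟨C₄, hC₄, h₄⟩ := exists_integral_norm_sq_le_interp
    (a := 1 / 2 + δ) (b := b) (by linarith) 9
  set D := C₂ + ((|b| + 3) * ‖riemannZeta b‖) ^ 4 with hD
  have hD0 : 0 < D := by positivity
  refine ⟨C₄ * D, by positivity, fun T hT σ hσ hσ' => ?_⟩
  have hT0 : 0 < T := by linarith
  have hz₁ := differentiable_riemannZeta₁
  have hz₂ := hz₁.continuous
  set f : ℂ → ℂ := fun s => riemannZeta₁ s ^ 2 / (T : ℂ) ^ 2 with hf
  have hfd : Differentiable ℂ f := by fun_prop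
  have hfc := hfd.continuous
  have hfn (s : ℂ) : ‖f s‖ = (‖riemannZeta₁ s‖ / T) ^ 2 := by
    rw [hf, norm_div, norm_pow, norm_pow, Complex.norm_real, Real.norm_of_nonneg hT0.le, div_pow]
  have hK (s : ℂ) (hs : 1 / 2 + δ ≤ s.re) (_ : s.re ≤ b) : ‖f s‖ ≤ C₃ ^ 2 * (1 + ‖s‖) ^ 4 := by
    rw [hfn]
    calc _ ≤ (C₃ * (1 + ‖s‖) ^ 2) ^ 2 := by
          gcongr
          exact (div_le_self (norm_nonneg _) hT).trans (h₃ s (by linarith))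
      _ = _ := by ring
  have hL (y : ℝ) : ∫ t in T..2 * T, ‖f (((1 / 2 + δ : ℝ) : ℂ) + ((t + y : ℝ) : ℂ) * I)‖ ^ 2 ≤
      D * T * (1 + |y|) ^ 9 := by
    refine (h₂ T y hT).trans ?_
    rw [Real.rpow_one]
    gcongr
    rw [hD]
    linarith [show 0 ≤ ((|b| + 3) * ‖riemannZeta b‖) ^ 4 by positivity]
  have hR (y : ℝ) : ∫ t in T..2 * T, ‖f ((b : ℂ) + ((t + y : ℝ) : ℂ) * I)‖ ^ 2 ≤
      D * T * (1 + |y|) ^ 9 := by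
    have hy := abs_nonneg y
    calc _ ≤ ∫ t in T..2 * T, ((|b| + 3) * ‖riemannZeta b‖) ^ 4 * (1 + |y|) ^ 4 := by
          refine intervalIntegral.integral_mono_on (by linarith)
            (Continuous.intervalIntegrable (by fun_prop) _ _) (by simp) fun t ht => ?_
          have h5 := norm_riemannZeta_le_norm_riemannZeta_re
            (s := (b : ℂ) + ((t + y : ℝ) : ℂ) * I) (by simpa using hb)
          have h6 := norm_line_sub_one_le b (y := y) hT ht.1 ht.2
          have h7 := ofReal_add_mul_I_ne_one hb.ne' (t + y)
          rw [hfn, riemannZeta₁_eq_mul h7, norm_mul]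
          have h8 : ((b : ℂ) + ((t + y : ℝ) : ℂ) * I).re = b := by simp
          rw [h8] at h5
          calc _ ≤ (((|b| + 3) * T * (1 + |y|) * ‖riemannZeta b‖ / T) ^ 2) ^ 2 := by gcongr
            _ = _ := by field_simp
      _ = ((|b| + 3) * ‖riemannZeta b‖) ^ 4 * T * (1 + |y|) ^ 4 := by
          rw [intervalIntegral.integral_const, smul_eq_mul]
          ring
      _ ≤ D * T * (1 + |y|) ^ 9 := by
          gcongr
          · rw [hD]
            linarith
          · linarith
          · norm_num
  have h5 := h₄ f hfd (C₃ ^ 2) 4 hK T (2 * T) (D * T) (D * T) (by linarith) (by positivity)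
    (by positivity) hL hR σ hσ hσ'
  rw [← Real.rpow_add (by positivity), sub_add_cancel, Real.rpow_one, ← mul_assoc] at h5
  refine (intervalIntegral_mono_of_nonneg (by linarith)
    (Continuous.intervalIntegrable (by fun_prop) _ _) fun t ht => ⟨by positivity, ?_⟩).trans h5
  have ht0 : T ≤ |t| := ht.1.le.trans (le_abs_self t)
  have h6 := ht0.trans (le_norm_line_sub_one σ t)
  have h7 : (σ : ℂ) + t * I ≠ 1 := fun h => by
    rw [h, sub_self, norm_zero] at h6
    linarith
  rw [hfn, riemannZeta₁_eq_mul h7, norm_mul, ← pow_mul]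
  gcongr
  rw [le_div_iff₀ hT0, mul_comm]
  gcongr

theorem one_le_norm_riemannZeta_product {x : ℝ} (hx : 0 < x) (y : ℝ) :
    1 ≤ ‖riemannZeta (1 + x)‖ ^ 3 * ‖riemannZeta (1 + x + I * y)‖ ^ 4 *
      ‖riemannZeta (1 + x + 2 * I * y)‖ := by
  have h := DirichletCharacter.norm_LFunction_product_ge_one (N := 1) 1 hx y
  rwa [one_pow, DirichletCharacter.LFunctionTrivChar, DirichletCharacter.LFunction_modOne_eq,
    norm_mul, norm_mul, norm_pow, norm_pow] at h

theorem exists_inv_norm_riemannZeta_le :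
    ∃ C > 0, ∀ x y T η : ℝ, 0 < x → x ≤ 1 → 1 ≤ T → T ≤ y → y ≤ 2 * T → 0 ≤ η → η ≤ 1 →
      1 / ‖riemannZeta (1 + x + I * y)‖ ≤ C * (x ^ (-1 + η / 4) * T ^ (η / 4)) := by
  obtain ⟨C, hC, h⟩ := exists_norm_riemannZeta₁_le
  refine ⟨25 * C, by positivity, fun x y T η hx hx' hT hy hy' hη hη' => ?_⟩
  have hT0 : 0 < T := by linarith
  have h1 : ‖riemannZeta (1 + x)‖ ≤ 25 * C / x := by
    have h2 := h (1 + x) (by simp; linarith)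
    have hne : (1 + x : ℂ) ≠ 1 := by simpa using hx.ne'
    have h3 : ‖(1 + x : ℂ)‖ ≤ 2 := by
      refine (norm_add_le _ _).trans ?_
      rw [norm_one, Complex.norm_real, Real.norm_of_nonneg hx.le]
      linarith
    rw [riemannZeta₁_eq_mul hne, norm_mul, add_sub_cancel_left, Complex.norm_real,
      Real.norm_of_nonneg hx.le] at h2
    rw [le_div_iff₀ hx, mul_comm]
    calc _ ≤ C * (1 + ‖(1 + x : ℂ)‖) ^ 2 := h2
      _ ≤ C * (1 + 2) ^ 2 := by gcongr
      _ ≤ 25 * C := by linarith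
  have h2 : ‖riemannZeta (1 + x + 2 * I * y)‖ ≤ 25 * C / x := by
    refine (norm_riemannZeta_le_norm_riemannZeta_re (by simpa using hx)).trans ?_
    simpa using h1
  have h3 : ‖riemannZeta (1 + x + 2 * I * y)‖ ≤ 25 * C * T := by
    have e : (1 + x + 2 * I * y : ℂ) = ((1 + x : ℝ) : ℂ) + ((2 * y : ℝ) : ℂ) * I := by
      push_cast
      ring
    rw [e]
    have h4 := h (((1 + x : ℝ) : ℂ) + ((2 * y : ℝ) : ℂ) * I) (by simp; linarith)
    rw [riemannZeta₁_eq_mul (ofReal_add_mul_I_ne_one (by linarith) _), norm_mul] at h4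
    have h5 := le_norm_line_sub_one (1 + x) (2 * y)
    have h6 : ‖((1 + x : ℝ) : ℂ) + ((2 * y : ℝ) : ℂ) * I‖ ≤ 2 + 4 * T := by
      refine (norm_add_le _ _).trans ?_
      rw [norm_mul, Complex.norm_I, mul_one, Complex.norm_real, Complex.norm_real,
        Real.norm_of_nonneg (by linarith), Real.norm_of_nonneg (by linarith)]
      linarith
    set w := ‖riemannZeta (((1 + x : ℝ) : ℂ) + ((2 * y : ℝ) : ℂ) * I)‖
    have hw : 0 ≤ w := norm_nonneg _
    rw [abs_of_nonneg (by linarith)] at h5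
    have h7 : 2 * T * w ≤ C * (7 * T) ^ 2 := by
      calc _ ≤ _ := mul_le_mul_of_nonneg_right (by linarith) hw
        _ ≤ _ := h4
        _ ≤ _ := by
          gcongr
          linarith
    have h8 : T * (2 * w) ≤ T * (49 * C * T) := by linarith
    have h9 := le_of_mul_le_mul_left h8 hT0
    have : 0 ≤ C * T := by positivity
    linarith
  have h4 : ‖riemannZeta (1 + x + 2 * I * y)‖ ≤ 25 * C * (x ^ (-1 + η) * T ^ η) := by
    set w := ‖riemannZeta (1 + x + 2 * I * y)‖
    have hw0 : 0 ≤ w := norm_nonneg _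
    rcases hw0.eq_or_lt with h0 | h0
    · rw [← h0]
      positivity
    calc w = w ^ (1 - η) * w ^ η := by rw [← Real.rpow_add h0, sub_add_cancel, Real.rpow_one]
      _ ≤ (25 * C / x) ^ (1 - η) * (25 * C * T) ^ η := by
          have : 0 ≤ 1 - η := by linarith
          gcongr
      _ = (25 * C) ^ (1 - η) * (25 * C) ^ η * ((x⁻¹) ^ (1 - η) * T ^ η) := by
          rw [div_eq_mul_inv, Real.mul_rpow (by positivity) (by positivity),
            Real.mul_rpow (x := 25 * C) (by positivity) (by positivity)]
          ring
      _ = _ := by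
          rw [← Real.rpow_add (by positivity), sub_add_cancel, Real.rpow_one,
            Real.inv_rpow hx.le, ← Real.rpow_neg hx.le, neg_sub, sub_eq_neg_add]
  set w := ‖riemannZeta (1 + x + I * y)‖ with hw
  have hw0 : 0 ≤ w := norm_nonneg _
  set P := x ^ (-1 + η / 4) * T ^ (η / 4) with hP
  have hP0 : 0 < P := by positivity
  have hP4 : P ^ 4 = x⁻¹ ^ 3 * (x ^ (-1 + η) * T ^ η) := by
    rw [hP, mul_pow, ← Real.rpow_mul_natCast hx.le, ← Real.rpow_mul_natCast hT0.le,
      inv_pow, ← Real.rpow_natCast x 3, ← Real.rpow_neg hx.le, ← mul_assoc, ← Real.rpow_add hx]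
    congr 2 <;> push_cast <;> ring
  have h5 : 1 ≤ (25 * C * P * w) ^ 4 := by
    calc 1 ≤ _ := one_le_norm_riemannZeta_product hx y
      _ ≤ (25 * C / x) ^ 3 * w ^ 4 * (25 * C * (x ^ (-1 + η) * T ^ η)) := by gcongr
      _ = (25 * C * w) ^ 4 * (x⁻¹ ^ 3 * (x ^ (-1 + η) * T ^ η)) := by
          rw [div_eq_mul_inv]
          ring
      _ = _ := by
          rw [← hP4]
          ring
  have h6 : 1 ≤ 25 * C * P * w := (one_le_pow_iff_of_nonneg (by positivity) (by norm_num)).1 h5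
  have h7 : 0 < w := by
    rcases hw0.eq_or_lt with h0 | h0
    · rw [← h0] at h6
      norm_num at h6
    · exact h0
  rw [div_le_iff₀ h7]
  exact h6

theorem integral_two_mul_sub_one_rpow {r : ℝ} (hr : 0 < r) :
    IntervalIntegrable (fun σ : ℝ => (2 * σ - 1) ^ (-1 + r)) MeasureTheory.volume (1 / 2) 1 ∧
      ∫ σ in (1 / 2 : ℝ)..1, (2 * σ - 1) ^ (-1 + r) = 1 / (2 * r) := by
  constructor
  · have h := intervalIntegral.intervalIntegrable_rpow' (a := 0) (b := 1) (r := -1 + r)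
      (by linarith)
    have h2 := (h.comp_sub_right 1).comp_mul_left (c := 2)
    convert h2 using 1 <;> norm_num
  · rw [intervalIntegral.integral_comp_mul_sub (fun u : ℝ => u ^ (-1 + r)) two_ne_zero,
      integral_rpow (Or.inl (by linarith))]
    norm_num
    rw [Real.zero_rpow hr.ne']
    ring

theorem integral_const_rpow {X : ℝ} (hX : 1 < X) (a b : ℝ) :
    ∫ σ in a..b, X ^ σ = (X ^ b - X ^ a) / Real.log X := by
  have hX0 : 0 < X := by linarith
  have hl := Real.log_pos hX
  rw [sub_div]
  refine intervalIntegral.integral_eq_sub_of_hasDerivAt (f := fun σ => X ^ σ / Real.log X)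
    (fun σ _ => ?_) ((Real.continuous_const_rpow hX0.ne').intervalIntegrable _ _)
  have h := (Real.hasStrictDerivAt_const_rpow hX0 σ).hasDerivAt.div_const (Real.log X)
  rwa [mul_div_cancel_right₀ _ hl.ne'] at h

theorem rpow_three_quarters_le {X : ℝ} (hX : 2 ≤ X) :
    X ^ (3 / 4 : ℝ) ≤ 16 * ((X - X ^ (1 / 2 : ℝ)) / Real.log X) := by
  have hX0 : 0 < X := by linarith
  have hl := Real.log_pos (by linarith : 1 < X)
  have h1 : X ^ (3 / 4 : ℝ) * X ^ (1 / 4 : ℝ) = X := by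
    rw [← Real.rpow_add hX0]
    norm_num
  have h2 := Real.log_le_rpow_div hX0.le (by norm_num : (0 : ℝ) < 1 / 4)
  have h3 : X ^ (1 / 2 : ℝ) ≤ 3 / 4 * X := by
    rw [← Real.sqrt_eq_rpow, Real.sqrt_le_left (by linarith)]
    nlinarith
  have h4 : X ^ (3 / 4 : ℝ) * Real.log X ≤ X ^ (3 / 4 : ℝ) * (X ^ (1 / 4 : ℝ) / (1 / 4)) := by
    gcongr
  rw [mul_div_assoc', le_div_iff₀ hl]
  linarith

theorem integral_two_mul_sub_one_rpow_mul_le {r X : ℝ} (hr : 0 < r) (hr' : r ≤ 1) (hX : 2 ≤ X) :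
    IntervalIntegrable (fun σ : ℝ => (2 * σ - 1) ^ (-1 + r) * X ^ σ) MeasureTheory.volume
      (1 / 2) 1 ∧
    ∫ σ in (1 / 2 : ℝ)..1, (2 * σ - 1) ^ (-1 + r) * X ^ σ ≤
      (8 / r + 2) * ((X - X ^ (1 / 2 : ℝ)) / Real.log X) := by
  have hX0 : 0 < X := by linarith
  obtain ⟨hi, he⟩ := integral_two_mul_sub_one_rpow hr
  have hc := Real.continuous_const_rpow hX0.ne'
  refine ⟨hi.mul_continuousOn hc.continuousOn, ?_⟩
  have h1 := rpow_three_quarters_le hX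
  calc _ ≤ ∫ σ in (1 / 2 : ℝ)..1, ((2 * σ - 1) ^ (-1 + r) * X ^ (3 / 4 : ℝ) + 2 * X ^ σ) := by
        refine intervalIntegral_mono_of_nonneg (by norm_num)
          ((hi.mul_const _).add ((hc.intervalIntegrable _ _).const_mul 2)) fun σ hσ => ?_
        have h0 : 0 < 2 * σ - 1 := by linarith [hσ.1]
        refine ⟨by positivity, ?_⟩
        rcases le_total σ (3 / 4) with h | h
        · have : (2 * σ - 1) ^ (-1 + r) * X ^ σ ≤ (2 * σ - 1) ^ (-1 + r) * X ^ (3 / 4 : ℝ) := by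
            gcongr
            linarith
          have : 0 < X ^ σ := by positivity
          linarith
        · have h2 : (2 * σ - 1) ^ (-1 + r) ≤ 2 := by
            calc _ ≤ (1 / 2 : ℝ) ^ (-1 + r) :=
                  Real.rpow_le_rpow_of_nonpos (by norm_num) (by linarith) (by linarith)
              _ ≤ (1 / 2 : ℝ) ^ (-1 : ℝ) :=
                  Real.rpow_le_rpow_of_exponent_ge (by norm_num) (by norm_num) (by linarith)
              _ = 2 := by norm_num [Real.rpow_neg_one]
          have h3 : (2 * σ - 1) ^ (-1 + r) * X ^ σ ≤ 2 * X ^ σ := by gcongr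
          have : 0 < (2 * σ - 1) ^ (-1 + r) * X ^ (3 / 4 : ℝ) := by positivity
          linarith
    _ = 1 / (2 * r) * X ^ (3 / 4 : ℝ) + 2 * ((X - X ^ (1 / 2 : ℝ)) / Real.log X) := by
        rw [intervalIntegral.integral_add (hi.mul_const _)
          ((hc.intervalIntegrable _ _).const_mul 2), intervalIntegral.integral_mul_const, he,
          intervalIntegral.integral_const_mul, integral_const_rpow (by linarith), Real.rpow_one]
    _ ≤ 1 / (2 * r) * (16 * ((X - X ^ (1 / 2 : ℝ)) / Real.log X)) +
          2 * ((X - X ^ (1 / 2 : ℝ)) / Real.log X) := by gcongr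
    _ = _ := by
        field_simp
        ring

theorem intervalIntegrable_norm_riemannZeta_pow_four (σ : ℝ) {a b : ℝ} (ha : 0 < a) (hab : a ≤ b) :
    IntervalIntegrable (fun t : ℝ => ‖riemannZeta ((σ : ℂ) + t * I)‖ ^ 4)
      MeasureTheory.volume a b := by
  refine ContinuousOn.intervalIntegrable fun t ht => ?_
  rw [Set.uIcc_of_le hab] at ht
  have hne : (σ : ℂ) + t * I ≠ 1 := fun h => by
    have := congrArg Complex.im h
    simp at this
    linarith [ht.1]
  have h1 : ContinuousAt riemannZeta ((σ : ℂ) + t * I) :=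
    (differentiableAt_riemannZeta hne).continuousAt
  have h2 : ContinuousAt (fun t : ℝ => (σ : ℂ) + t * I) t := by fun_prop
  exact ((ContinuousAt.comp (f := fun t : ℝ => (σ : ℂ) + t * I) h1 h2).norm.pow
    4).continuousWithinAt

theorem exists_integral_norm_riemannZeta_pow_four_le_translate {z : ℂ} (hz : 0 < z.re) :
    ∃ C > 0, ∀ σ T : ℝ, 1 / 2 ≤ σ → σ ≤ 1 → 4 * (1 + |z.im|) + 3 ≤ T →
      ∫ t in (T / 2 + z.im)..(T + z.im), ‖riemannZeta (((σ + z.re : ℝ) : ℂ) + t * I)‖ ^ 4 ≤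
        C * T := by
  obtain ⟨C, hC, h⟩ := exists_integral_norm_riemannZeta_pow_four_le_uniform
    (δ := min z.re (1 / 8)) (lt_min hz (by norm_num)) (min_le_right _ _) (b := 1 + z.re)
    (by linarith)
  refine ⟨2 * C, by positivity, fun σ T hσ hσ' hT => ?_⟩
  have hi := abs_nonneg z.im
  have hi1 := neg_abs_le z.im
  have hi2 := le_abs_self z.im
  have hw (U : ℝ) (hU : 1 ≤ U) := h U hU (σ + z.re) (by linarith [min_le_left z.re (1 / 8)])
    (by linarith)
  have hI {a b : ℝ} (ha : 0 < a) (hab : a ≤ b) :=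
    intervalIntegrable_norm_riemannZeta_pow_four (σ + z.re) ha hab
  have h1 := hw (T / 4) (by linarith)
  have h2 := hw (T / 2) (by linarith)
  have h3 := hw T (by linarith)
  rw [show 2 * (T / 4) = T / 2 by ring] at h1
  rw [show 2 * (T / 2) = T by ring] at h2
  calc _ ≤ ∫ t in (T / 4)..(2 * T), ‖riemannZeta (((σ + z.re : ℝ) : ℂ) + t * I)‖ ^ 4 :=
        intervalIntegral.integral_mono_interval (by linarith) (by linarith) (by linarith)
          (Filter.Eventually.of_forall fun t => by positivity) (hI (by linarith) (by linarith))
    _ = (∫ t in (T / 4)..(T / 2), ‖riemannZeta (((σ + z.re : ℝ) : ℂ) + t * I)‖ ^ 4) +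
        (∫ t in (T / 2)..T, ‖riemannZeta (((σ + z.re : ℝ) : ℂ) + t * I)‖ ^ 4) +
        ∫ t in T..(2 * T), ‖riemannZeta (((σ + z.re : ℝ) : ℂ) + t * I)‖ ^ 4 := by
        rw [intervalIntegral.integral_add_adjacent_intervals (hI (by linarith) (by linarith))
          (hI (by linarith) (by linarith)), intervalIntegral.integral_add_adjacent_intervals
          (hI (by linarith) (by linarith)) (hI (by linarith) (by linarith))]
    _ ≤ _ := by
        have : 0 ≤ C * T := mul_nonneg hC.le (by linarith)
        linarith

theorem three_halves_le_log {T : ℝ} (hT : 7 ≤ T) : 3 / 2 ≤ Real.log T := by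
  have h1 : (3 : ℝ) ≤ Real.log (T ^ 2) := by
    rw [Real.le_log_iff_exp_le (by positivity)]
    have h2 : Real.exp 3 = Real.exp 1 ^ 3 := by rw [← Real.exp_nat_mul]; norm_num
    have h3 : Real.exp 1 ^ 3 ≤ 3 ^ 3 := by
      gcongr
      linarith [Real.exp_one_lt_d9]
    nlinarith
  rw [Real.log_pow] at h1
  push_cast at h1
  linarith

theorem exists_integral_strip_inner_le {z : ℂ} (hz : 0 < z.re) :
    ∃ C > 0, ∀ x T σ : ℝ, 0 < x → 4 * (1 + |z.im|) + 3 ≤ T → 1 / 2 < σ → σ ≤ 1 →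
      ∫ t in (T / 2)..T, ‖riemannZeta ((σ : ℂ) + (t : ℂ) * Complex.I + z)‖ ^ 4 /
            ‖riemannZeta (2 * ((σ : ℂ) + (t : ℂ) * Complex.I))‖ *
            x ^ σ / ‖(σ : ℂ) + (t : ℂ) * Complex.I‖ ≤
        C * ((2 * σ - 1) ^ (-1 + 1 / (4 * Real.log T)) * x ^ σ) := by
  obtain ⟨C, hC, h⟩ := exists_integral_norm_riemannZeta_pow_four_le_translate hz
  obtain ⟨D, hD, h'⟩ := exists_inv_norm_riemannZeta_le
  refine ⟨4 * C * D * Real.exp (1 / 4), by positivity, fun x T σ hx hT hσ hσ' => ?_⟩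
  have hi := abs_nonneg z.im
  have hT0 : 0 < T := by linarith
  have hL := three_halves_le_log (T := T) (by linarith)
  have hs0 : 0 < 2 * σ - 1 := by linarith
  set L := Real.log T with hLd
  set P := (2 * σ - 1) ^ (-1 + 1 / (4 * L)) with hP
  have hP0 : 0 < P := by positivity
  have hTe : T ^ (1 / L / 4) = Real.exp (1 / 4) := by
    rw [Real.rpow_def_of_pos hT0, ← hLd]
    congr 1
    field_simp
  have hinv (t : ℝ) (ht : T / 2 ≤ t) (ht' : t ≤ T) :
      1 / ‖riemannZeta (2 * ((σ : ℂ) + t * I))‖ ≤ D * (P * Real.exp (1 / 4)) := by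
    have h1 := h' (2 * σ - 1) (2 * t) T (1 / L) hs0 (by linarith) (by linarith) (by linarith)
      (by linarith) (by positivity) (by rw [div_le_one (by linarith)]; linarith)
    rw [hTe, div_div, mul_comm L 4, ← hP] at h1
    convert h1 using 5
    push_cast
    ring
  have e (t : ℝ) : (σ : ℂ) + t * I + z = ((σ + z.re : ℝ) : ℂ) + ((t + z.im : ℝ) : ℂ) * I := by
    conv_lhs => rw [← Complex.re_add_im z]
    push_cast
    ring
  set K := D * (P * Real.exp (1 / 4)) * x ^ σ * (2 / T) with hK
  have hK0 : 0 ≤ K := by positivity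
  have hgi := (intervalIntegrable_norm_riemannZeta_pow_four (σ + z.re)
    (a := T / 2 + z.im) (b := T + z.im) (by linarith [neg_abs_le z.im])
    (by linarith)).comp_add_right z.im
  rw [add_sub_cancel_right, add_sub_cancel_right] at hgi
  calc _ ≤ ∫ t in (T / 2)..T,
        K * ‖riemannZeta (((σ + z.re : ℝ) : ℂ) + ((t + z.im : ℝ) : ℂ) * I)‖ ^ 4 := by
        refine intervalIntegral_mono_of_nonneg (by linarith) (hgi.const_mul K)
          fun t ht => ⟨by positivity, ?_⟩
        rw [e]
        have h1 := hinv t ht.1.le ht.2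
        have h2 : T / 2 ≤ ‖(σ : ℂ) + t * I‖ := by
          refine le_trans ?_ (Complex.abs_im_le_norm _)
          simpa using ht.1.le.trans (le_abs_self t)
        have h3 : 1 / ‖(σ : ℂ) + t * I‖ ≤ 2 / T := by
          rw [div_le_div_iff₀ (by linarith) hT0]
          linarith
        set w := ‖riemannZeta (((σ + z.re : ℝ) : ℂ) + ((t + z.im : ℝ) : ℂ) * I)‖ ^ 4
        calc _ = 1 / ‖riemannZeta (2 * ((σ : ℂ) + t * I))‖ * x ^ σ *
              (1 / ‖(σ : ℂ) + t * I‖) * w := by ring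
          _ ≤ _ := by
            rw [hK]
            gcongr
    _ = K * ∫ t in (T / 2 + z.im)..(T + z.im),
        ‖riemannZeta (((σ + z.re : ℝ) : ℂ) + t * I)‖ ^ 4 := by
        rw [intervalIntegral.integral_const_mul, intervalIntegral.integral_comp_add_right
          (fun t : ℝ => ‖riemannZeta (((σ + z.re : ℝ) : ℂ) + t * I)‖ ^ 4)]
    _ ≤ K * (C * T) := mul_le_mul_of_nonneg_left (h σ T hσ.le hσ' hT) hK0
    _ ≤ _ := by
        rw [hK]
        have : D * (P * Real.exp (1 / 4)) * x ^ σ * (2 / T) * (C * T) =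
            2 * C * D * Real.exp (1 / 4) * (P * x ^ σ) := by
          field_simp
        rw [this]
        gcongr
        norm_num

theorem zeta_fourth_moment_strip (z : ℂ) (hz : 0 < z.re) :
    ∃ C > 0, ∀ x T : ℝ, 2 ≤ x → 4 * (1 + |z.im|) + 3 ≤ T →
      (∫ σ in (1 / 2 : ℝ)..1, ∫ t in (T / 2)..T,
          ‖riemannZeta ((σ : ℂ) + (t : ℂ) * Complex.I + z)‖ ^ 4 /
            ‖riemannZeta (2 * ((σ : ℂ) + (t : ℂ) * Complex.I))‖ *
            x ^ σ / ‖(σ : ℂ) + (t : ℂ) * Complex.I‖) ≤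
        C * (Real.log T) ^ 4 * Real.log (Real.log T) * (x - x ^ ((1 : ℝ) / 2)) / Real.log x := by
  obtain ⟨C, hC, h⟩ := exists_integral_strip_inner_le hz
  refine ⟨C * 102, by positivity, fun x T hx hT => ?_⟩
  have hi := abs_nonneg z.im
  have hT0 : 0 < T := by linarith
  have hx0 : 0 < x := by linarith
  have hL := three_halves_le_log (T := T) (by linarith)
  set L := Real.log T
  have hLL : 1 / 3 ≤ Real.log L := by
    have h1 := Real.one_sub_inv_le_log_of_pos (by linarith : 0 < L)
    have h2 : L⁻¹ ≤ (3 / 2)⁻¹ := by gcongr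
    linarith
  obtain ⟨hi, hI⟩ := integral_two_mul_sub_one_rpow_mul_le (r := 1 / (4 * L)) (X := x)
    (by positivity) (by rw [div_le_one (by linarith)]; linarith) hx
  set R := (x - x ^ ((1 : ℝ) / 2)) / Real.log x with hR
  have hR0 : 0 ≤ R := by
    have h1 := rpow_three_quarters_le hx
    have : 0 < x ^ (3 / 4 : ℝ) := by positivity
    linarith
  calc _ ≤ ∫ σ in (1 / 2 : ℝ)..1, C * ((2 * σ - 1) ^ (-1 + 1 / (4 * L)) * x ^ σ) :=
        intervalIntegral_mono_of_nonneg (by norm_num) (hi.const_mul C) fun σ hσ =>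
          ⟨intervalIntegral.integral_nonneg (by linarith) fun t _ => by positivity,
            h x T σ hx0 hT hσ.1 hσ.2⟩
    _ ≤ C * ((8 / (1 / (4 * L)) + 2) * R) := by
        rw [intervalIntegral.integral_const_mul]
        gcongr
    _ ≤ C * (102 * L ^ 4 * Real.log L * R) := by
        gcongr
        have h1 : L ≤ L ^ 4 := le_self_pow₀ (by linarith) (by norm_num)
        have h2 : L ^ 4 * (1 / 3) ≤ L ^ 4 * Real.log L := by gcongr
        have h3 : 8 / (1 / (4 * L)) = 32 * L := by
          field_simp
          ring
        rw [h3]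
        linarith
    _ = _ := by rw [hR]; ring
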